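/- arXiv:2302.00713 — 5 statements merged into one kernel-verified Lean document; each statement's English description precedes it below -/
import Mathlib

section
/- Let (𝒳,ℓ_X) and (𝒴,ℓ_Y) be Z-labeled measure Markov chains on finite state spaces and k ∈ ℕ. Define V_i : X^{i+1}×Y^{i+1} → ℝ by the backward recursion V_k(x_0,…,x_k,y_0,…,y_k) := d_Z(ℓ_X(x_k),ℓ_Y(y_k)) and V_{i−1}(x_0,…,x_{i−1},y_0,…,y_{i−1}) := inf over couplings ν^i of (α^k_{x_0,…,x_{i−1}}, β^k_{y_0,…,y_{i−1}}) of E_{ν^i}[V_i(x_0,…,x_{i−1},X_i,y_0,…,y_{i−1},Y_i)], where α^k_{x_0,…,x_{i−1}} and β^k_{y_0,…,y_{i−1}} are the conditional laws of the next coordinate of α^k and β^k given the past. Similarly define W_i : X×Y → ℝ by W_k(x_k,y_k) := d_Z(ℓ_X(x_k),ℓ_Y(y_k)) and W_{i−1}(x_{i−1},y_{i−1}) := inf over couplings ν^i of (α^k_{x_{i−1}}, β^k_{y_{i−1}}) of E_{ν^i}[W_i(X_i,Y_i)], where α^k_{x_{i−1}} and β^k_{y_{i−1}} are the one-step conditional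 laws. Then for all i ∈ {0,…,k−1} and all (x_0,…,x_i,y_0,…,y_i) ∈ X^{i+1}×Y^{i+1}, one has V_i(x_0,…,x_i,y_0,…,y_i) = W_i(x_i,y_i). -/
/-!
STATEMENT 4: For labeled measure Markov chains `(𝒳,ℓ_X)`, `(𝒴,ℓ_Y)` on finite state spaces
and `k ∈ ℕ`, define `V_i` on histories `(x_0,…,x_i,y_0,…,y_i)` by the backward recursion
`V_k = d_Z(ℓ_X(x_k),ℓ_Y(y_k))` and
`V_{i−1} = inf over couplings ν of (α^k_{x_0…x_{i−1}}, β^k_{y_0…y_{i−1}}) of E_ν[V_i]`,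
and define `W_i` on `X × Y` by the analogous recursion using the one-step conditional laws
`α^k_{x_{i−1}}, β^k_{y_{i−1}}`. Then `V_i(x_0,…,x_i,y_0,…,y_i) = W_i(x_i,y_i)` for all
`0 ≤ i ≤ k−1`.

Histories are encoded as functions `ℕ → X` (only the first `i+1` values are relevant), and
`V i` is `Vaux (k−i)`, `W i` is `Waux (k−i)` below.  Conditional laws of `α^k` are defined
by the usual ratio of cylinder masses on non-null events; on null events they are taken to
be the disintegration kernel `m^X_{x_{i−1}}` (cf. the disintegration convention in the
paper's footnote).
-/

open Finset

noncomputable section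

variable {X Y Z : Type*} [Fintype X] [Fintype Y] [PseudoMetricSpace Z]

/-- `π` is a coupling of the two probability vectors `p : A → ℝ` and `p' : B → ℝ`. -/
def IsCouplingFn {A B : Type*} [Fintype A] [Fintype B] (π : A × B → ℝ)
    (p : A → ℝ) (p' : B → ℝ) : Prop :=
  (∀ r, 0 ≤ π r) ∧ (∀ a, ∑ b, π (a, b) = p a) ∧ (∀ b, ∑ a, π (a, b) = p' b)

/-- The mass that `α^k` gives to the cylinder fixing the first `i+1` coordinates to be
`xs 0, …, xs i`:  `μ(xs 0) ∏_{j<i} m_{xs j}(xs (j+1))`. -/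
def hw (μ : X → ℝ) (m : X → X → ℝ) (i : ℕ) (xs : ℕ → X) : ℝ :=
  μ (xs 0) * ∏ j ∈ Finset.range i, m (xs j) (xs (j + 1))

/-- The conditional law `α^k_{x_0,…,x_i}` of the coordinate `i+1` of `α^k` given that the
first `i+1` coordinates equal `xs 0, …, xs i`: the ratio of cylinder masses on non-null
events, and the disintegration kernel `m_{xs i}` on null events. -/
def condPast (μ : X → ℝ) (m : X → X → ℝ) (i : ℕ) (xs : ℕ → X) (x : X) : ℝ :=
  if hw μ m i xs ≠ 0 then hw μ m (i + 1) (Function.update xs (i + 1) x) / hw μ m i xs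
  else m (xs i) x

/-- The law of the `i`-th coordinate of `α^k` (the `i`-step marginal of the chain). -/
def marg (μ : X → ℝ) (m : X → X → ℝ) : ℕ → X → ℝ
  | 0 => μ
  | i + 1 => fun x' => ∑ x, marg μ m i x * m x x'

/-- The one-step conditional law `α^k_{x}` of coordinate `i+1` of `α^k` given that
coordinate `i` equals `x`: the ratio `α^k(X_i = x, X_{i+1} = x')/α^k(X_i = x)` on non-null
events, and the disintegration kernel `m_x` on null events. -/
def condOne (μ : X → ℝ) (m : X → X → ℝ) (i : ℕ) (x : X) (x' : X) : ℝ :=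
  if marg μ m i x ≠ 0 then marg μ m i x * m x x' / marg μ m i x else m x x'

/-- `Vaux … j = V_{k-j}`: the value functions of the bicausal OT problem, computed by the
backward recursion on full histories.  `Vaux … 0 xs ys = d_Z(ℓ_X(x_k), ℓ_Y(y_k))` and
`V_{i-1}(x_0,…,x_{i-1},y_0,…,y_{i-1})
  = inf_{ν ∈ C(α^k_{x_0,…,x_{i-1}}, β^k_{y_0,…,y_{i-1}})} E_ν[V_i]`. -/
def Vaux (μX : X → ℝ) (mX : X → X → ℝ) (μY : Y → ℝ) (mY : Y → Y → ℝ)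
    (lX : X → Z) (lY : Y → Z) (k : ℕ) : ℕ → (ℕ → X) → (ℕ → Y) → ℝ
  | 0, xs, ys => dist (lX (xs k)) (lY (ys k))
  | j + 1, xs, ys =>
    sInf {r : ℝ | ∃ ν : X × Y → ℝ,
      IsCouplingFn ν (condPast μX mX (k - j - 1) xs) (condPast μY mY (k - j - 1) ys) ∧
      r = ∑ p : X × Y, ν p *
        Vaux μX mX μY mY lX lY k j
          (Function.update xs (k - j) p.1) (Function.update ys (k - j) p.2)}

/-- `Waux … j = W_{k-j}`: the analogous backward recursion using the one-step conditional
laws: `Waux … 0 x y = d_Z(ℓ_X(x), ℓ_Y(y))` and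
`W_{i-1}(x_{i-1},y_{i-1}) = inf_{ν ∈ C(α^k_{x_{i-1}}, β^k_{y_{i-1}})} E_ν[W_i]`. -/
def Waux (μX : X → ℝ) (mX : X → X → ℝ) (μY : Y → ℝ) (mY : Y → Y → ℝ)
    (lX : X → Z) (lY : Y → Z) (k : ℕ) : ℕ → X → Y → ℝ
  | 0, x, y => dist (lX x) (lY y)
  | j + 1, x, y =>
    sInf {r : ℝ | ∃ ν : X × Y → ℝ,
      IsCouplingFn ν (condOne μX mX (k - j - 1) x) (condOne μY mY (k - j - 1) y) ∧
      r = ∑ p : X × Y, ν p * Waux μX mX μY mY lX lY k j p.1 p.2}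

end

/-- The conditional law of the next coordinate given the past is the Markov kernel at the
present state. -/
theorem condPast_eq {X : Type*} [Fintype X] (μ : X → ℝ) (m : X → X → ℝ) (i : ℕ) (xs : ℕ → X) :
    condPast μ m i xs = m (xs i) := by
  funext x
  unfold condPast
  split_ifs with h
  · have hupd : hw μ m (i + 1) (Function.update xs (i + 1) x) = hw μ m i xs * m (xs i) x := by
      unfold hw
      have hprod : ∏ j ∈ Finset.range i, m (Function.update xs (i + 1) x j)
          (Function.update xs (i + 1) x (j + 1)) =
          ∏ j ∈ Finset.range i, m (xs j) (xs (j + 1)) := by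
        refine Finset.prod_congr rfl fun j hj => ?_
        have hj' := Finset.mem_range.mp hj
        rw [Function.update_of_ne (by omega), Function.update_of_ne (by omega)]
      rw [Finset.prod_range_succ, hprod, Function.update_self,
        Function.update_of_ne (by omega), Function.update_of_ne (by omega), mul_assoc]
    rw [hupd, mul_div_cancel_left₀ _ h]
  · rfl

/-- The one-step conditional law is the Markov kernel. -/
theorem condOne_eq {X : Type*} [Fintype X] (μ : X → ℝ) (m : X → X → ℝ) (i : ℕ) (x : X) :
    condOne μ m i x = m x := by
  funext x'
  unfold condOne
  split_ifs with h
  · exact mul_div_cancel_left₀ _ h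
  · rfl

/-- The value functions on histories depend only on the present states. -/
theorem Vaux_eq_Waux {X Y Z : Type*} [Fintype X] [Fintype Y] [PseudoMetricSpace Z]
    (μX : X → ℝ) (mX : X → X → ℝ) (μY : Y → ℝ) (mY : Y → Y → ℝ)
    (lX : X → Z) (lY : Y → Z) (k j : ℕ) (xs : ℕ → X) (ys : ℕ → Y) :
    Vaux μX mX μY mY lX lY k j xs ys =
      Waux μX mX μY mY lX lY k j (xs (k - j)) (ys (k - j)) := by
  induction j generalizing xs ys with
  | zero => rfl
  | succ j ih =>
    simp only [Vaux, Waux, condPast_eq, condOne_eq, ih, Function.update_self, Nat.sub_sub]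

/-- `V_i(x_0,…,x_i,y_0,…,y_i) = W_i(x_i,y_i)` for all `i ∈ {0,…,k−1}`. -/
theorem V_eq_W {X Y Z : Type*} [Fintype X] [Fintype Y] [PseudoMetricSpace Z]
    (μX : X → ℝ) (mX : X → X → ℝ) (μY : Y → ℝ) (mY : Y → Y → ℝ)
    (lX : X → Z) (lY : Y → Z)
    (hμX0 : ∀ x, 0 ≤ μX x) (hμX1 : ∑ x, μX x = 1)
    (hmX0 : ∀ x x', 0 ≤ mX x x') (hmX1 : ∀ x, ∑ x', mX x x' = 1)
    (hsX : ∀ x', ∑ x, μX x * mX x x' = μX x')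
    (hμY0 : ∀ y, 0 ≤ μY y) (hμY1 : ∑ y, μY y = 1)
    (hmY0 : ∀ y y', 0 ≤ mY y y') (hmY1 : ∀ y, ∑ y', mY y y' = 1)
    (hsY : ∀ y', ∑ y, μY y * mY y y' = μY y')
    (k i : ℕ) (hi : i < k) (xs : ℕ → X) (ys : ℕ → Y) :
    Vaux μX mX μY mY lX lY k (k - i) xs ys =
      Waux μX mX μY mY lX lY k (k - i) (xs i) (ys i) := by
  rw [Vaux_eq_Waux, Nat.sub_sub_self hi.le]
end

section
/- For any k ∈ ℕ and any Z-labeled measure Markov chains (𝒳,ℓ_X) and (𝒴,ℓ_Y) on finite state spaces, d_WL^(k)((𝒳,ℓ_X),(𝒴,ℓ_Y)) = d^{c^k}(α^k, β^k), i.e. the Weisfeiler–Lehman distance of depth k equals the bicausal optimal transport cost between α^k and β^k with cost function c^k((x_0,…,x_k),(y_0,…,y_k)) = d_Z(ℓ_X(x_k), ℓ_Y(y_k)). -/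
/-!
STATEMENT 5: For any `k ∈ ℕ` and any Z-labeled measure Markov chains `(𝒳,ℓ_X)` and
`(𝒴,ℓ_Y)` on finite state spaces, `d_WL^{(k)}((𝒳,ℓ_X),(𝒴,ℓ_Y)) = d^{c^k}(α^k, β^k)`:
the Weisfeiler–Lehman distance of depth `k` equals the bicausal optimal transport cost
between the length-`(k+1)` path laws `α^k` and `β^k`, with cost
`c^k((x_0,…,x_k),(y_0,…,y_k)) = d_Z(ℓ_X(x_k), ℓ_Y(y_k))`.
-/

open Finset

noncomputable section

/-- A 1-step coupling between the Markov kernels `mA` and `mB`. -/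
def IsOneStepCoupling {A B : Type*} [Fintype A] [Fintype B]
    (mA : A → A → ℝ) (mB : B → B → ℝ) (ν : A × B → A × B → ℝ) : Prop :=
  ∀ p, IsCouplingFn (ν p) (mA p.1) (mB p.2)

/-- `k`-step couplings between the Markov kernels `mA` and `mB` (for `k = 0`, the identity
kernel, so that `ν^{(0)} ⊙ γ = γ`). -/
inductive IsKStepCoupling {A B : Type*} [Fintype A] [Fintype B] [DecidableEq A] [DecidableEq B]
    (mA : A → A → ℝ) (mB : B → B → ℝ) : ℕ → (A × B → A × B → ℝ) → Prop
  | zero (ν : A × B → A × B → ℝ) (h : ∀ p r, ν p r = if r = p then 1 else 0) :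
      IsKStepCoupling mA mB 0 ν
  | one (ν : A × B → A × B → ℝ) (h : IsOneStepCoupling mA mB ν) : IsKStepCoupling mA mB 1 ν
  | succ (k : ℕ) (ν' ν₁ ν : A × B → A × B → ℝ) (h' : IsKStepCoupling mA mB k ν')
      (h₁ : IsOneStepCoupling mA mB ν₁) (h : ∀ p r, ν p r = ∑ s, ν₁ p s * ν' s r) :
      IsKStepCoupling mA mB (k + 1) ν

/-- `ν ⊙ γ := ∫ ν_{x,y} γ(dx×dy)`. -/
def odotFn {A B : Type*} [Fintype A] [Fintype B]
    (ν : A × B → A × B → ℝ) (γ : A × B → ℝ) : A × B → ℝ :=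
  fun r => ∑ p, γ p * ν p r

/-- The Weisfeiler–Lehman distance of depth `k`, via its `k`-step coupling
characterization. -/
def dWL {A B Z : Type*} [Fintype A] [Fintype B] [DecidableEq A] [DecidableEq B]
    [PseudoMetricSpace Z] (k : ℕ)
    (mA : A → A → ℝ) (μA : A → ℝ) (lA : A → Z)
    (mB : B → B → ℝ) (μB : B → ℝ) (lB : B → Z) : ℝ :=
  sInf {r : ℝ | ∃ γ ν, IsCouplingFn γ μA μB ∧ IsKStepCoupling mA mB k ν ∧
    r = ∑ p : A × B, odotFn ν γ p * dist (lA p.1) (lB p.2)}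

/-- The law `α^k` on paths of length `k+1`:
`α^k(x_0,…,x_k) = μ(x_0) m_{x_0}(x_1) ⋯ m_{x_{k−1}}(x_k)`. -/
def pathW {A : Type*} [Fintype A] (μ : A → ℝ) (m : A → A → ℝ) (k : ℕ)
    (xs : Fin (k + 1) → A) : ℝ :=
  μ (xs 0) * ∏ i : Fin k, m (xs i.castSucc) (xs i.succ)

/-- Causality of a coupling `π` of two path laws, from the first to the second factor:
for all `0 ≤ l ≤ k`, `π((y_0,…,y_l) | (x_0,…,x_k)) = π((y_0,…,y_l) | (x_0,…,x_l))`,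
written multiplicatively (so that it is exactly the conditional-probability statement
whenever the conditioning events are non-null). -/
def IsCausalFn {A B : Type*} [Fintype A] [Fintype B] [DecidableEq A] [DecidableEq B] (k : ℕ)
    (π : (Fin (k + 1) → A) → (Fin (k + 1) → B) → ℝ) : Prop :=
  ∀ l ≤ k, ∀ (xs : Fin (k + 1) → A) (ys : Fin (k + 1) → B),
    (∑ ys' : Fin (k + 1) → B,
        if ∀ i : Fin (k + 1), (i : ℕ) ≤ l → ys' i = ys i then π xs ys' else 0) *
      (∑ xs' : Fin (k + 1) → A, ∑ ys' : Fin (k + 1) → B,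
        if ∀ i : Fin (k + 1), (i : ℕ) ≤ l → xs' i = xs i then π xs' ys' else 0) =
    (∑ xs' : Fin (k + 1) → A, ∑ ys' : Fin (k + 1) → B,
        if (∀ i : Fin (k + 1), (i : ℕ) ≤ l → xs' i = xs i) ∧
           (∀ i : Fin (k + 1), (i : ℕ) ≤ l → ys' i = ys i) then π xs' ys' else 0) *
      (∑ ys' : Fin (k + 1) → B, π xs ys')

/-- The bicausal optimal transport cost `d^{c^k}(α^k, β^k)` between the path laws of the
two chains, with cost `c^k((x_0,…,x_k),(y_0,…,y_k)) = d_Z(ℓ_X(x_k), ℓ_Y(y_k))`. -/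
def dBC {X Y Z : Type*} [Fintype X] [Fintype Y] [DecidableEq X] [DecidableEq Y]
    [PseudoMetricSpace Z] (k : ℕ)
    (mX : X → X → ℝ) (μX : X → ℝ) (lX : X → Z)
    (mY : Y → Y → ℝ) (μY : Y → ℝ) (lY : Y → Z) : ℝ :=
  sInf {r : ℝ | ∃ π : (Fin (k + 1) → X) → (Fin (k + 1) → Y) → ℝ,
    (∀ xs ys, 0 ≤ π xs ys) ∧
    (∀ xs, ∑ ys, π xs ys = pathW μX mX k xs) ∧
    (∀ ys, ∑ xs, π xs ys = pathW μY mY k ys) ∧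
    IsCausalFn k π ∧ IsCausalFn k (fun ys xs => π xs ys) ∧
    r = ∑ xs, ∑ ys, π xs ys * dist (lX (xs (Fin.last k))) (lY (ys (Fin.last k)))}

end

/-- The two paths agree up to and including time `l`. -/
def AgreeUpTo {A : Type*} {k : ℕ} (l : ℕ) (xs' xs : Fin (k + 1) → A) : Prop :=
  ∀ i : Fin (k + 1), (i : ℕ) ≤ l → xs' i = xs i

instance {A : Type*} [DecidableEq A] {k : ℕ} (l : ℕ) (xs' xs : Fin (k + 1) → A) :
    Decidable (AgreeUpTo l xs' xs) :=
  inferInstanceAs (Decidable (∀ i : Fin (k + 1), (i : ℕ) ≤ l → xs' i = xs i))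

theorem isCausalFn_iff {A B : Type*} [Fintype A] [Fintype B] [DecidableEq A] [DecidableEq B]
    {k : ℕ} {π : (Fin (k + 1) → A) → (Fin (k + 1) → B) → ℝ} :
    IsCausalFn k π ↔ ∀ l ≤ k, ∀ (xs : Fin (k + 1) → A) (ys : Fin (k + 1) → B),
      (∑ ys', if AgreeUpTo l ys' ys then π xs ys' else 0) *
        (∑ xs', ∑ ys', if AgreeUpTo l xs' xs then π xs' ys' else 0) =
      (∑ xs', ∑ ys', if AgreeUpTo l xs' xs ∧ AgreeUpTo l ys' ys then π xs' ys' else 0) *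
        ∑ ys', π xs ys' :=
  Iff.rfl

/-- Weight of a path under an initial weight and time-inhomogeneous transition weights. -/
def pathWeight {S : Type*} {k : ℕ} (g : S → ℝ) (w : Fin k → S → S → ℝ)
    (zs : Fin (k + 1) → S) : ℝ :=
  g (zs 0) * ∏ i : Fin k, w i (zs i.castSucc) (zs i.succ)

theorem AgreeUpTo.congr_right {A : Type*} {k l : ℕ} {xs xs' : Fin (k + 1) → A}
    (h : AgreeUpTo l xs' xs) (zs : Fin (k + 1) → A) :
    AgreeUpTo l zs xs' ↔ AgreeUpTo l zs xs :=
  forall₂_congr (p := fun (i : Fin (k + 1)) (_ : (i : ℕ) ≤ l) => zs i = xs' i)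
    fun i hi => by rw [h i hi]

theorem sum_fin_snoc {A : Type*} [Fintype A] {n : ℕ} (F : (Fin (n + 1) → A) → ℝ) :
    ∑ zs, F zs = ∑ us : Fin n → A, ∑ a : A, F (Fin.snoc us a) := by
  rw [← (Fin.snocEquiv (fun _ : Fin (n + 1) => A)).sum_comp, Fintype.sum_prod_type_right]
  rfl

theorem sum_fin_cons {A : Type*} [Fintype A] {n : ℕ} (F : (Fin (n + 1) → A) → ℝ) :
    ∑ zs, F zs = ∑ a : A, ∑ us : Fin n → A, F (Fin.cons a us) := by
  rw [← (Fin.consEquiv (fun _ : Fin (n + 1) => A)).sum_comp, Fintype.sum_prod_type]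
  rfl

theorem pathWeight_snoc {S : Type*} {k : ℕ} (g : S → ℝ) (w : Fin (k + 1) → S → S → ℝ)
    (us : Fin (k + 1) → S) (a : S) :
    pathWeight g w (Fin.snoc us a) =
      pathWeight g (fun i => w i.castSucc) us * w (Fin.last k) (us (Fin.last k)) a := by
  have h0 : (Fin.snoc us a : Fin (k + 2) → S) 0 = us 0 := by
    rw [← Fin.castSucc_zero, Fin.snoc_castSucc]
  simp only [pathWeight, Fin.prod_univ_castSucc, Fin.snoc_castSucc, Fin.succ_last, Fin.snoc_last,
    ← Fin.castSucc_succ, h0, mul_assoc]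

theorem pathWeight_cons {S : Type*} {k : ℕ} (g : S → ℝ) (w : Fin (k + 1) → S → S → ℝ)
    (us : Fin (k + 1) → S) (a : S) :
    pathWeight g w (Fin.cons a us) =
      g a * pathWeight (w 0 a) (fun i => w i.succ) us := by
  simp [pathWeight, Fin.prod_univ_succ]

theorem sum_pathWeight {A : Type*} [Fintype A] {k : ℕ} (g : A → ℝ)
    (w : Fin k → A → A → ℝ) (c : Fin k → ℝ) (h : ∀ i y, ∑ y', w i y y' = c i) :
    ∑ ys, pathWeight g w ys = (∑ y, g y) * ∏ i, c i := by
  induction k with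
  | zero =>
    rw [sum_fin_cons]
    simp [pathWeight]
  | succ k ih =>
    rw [sum_fin_snoc]
    simp_rw [pathWeight_snoc, ← Finset.mul_sum, h, ← Finset.sum_mul]
    rw [ih _ _ fun i y => h i.castSucc y, Fin.prod_univ_castSucc, mul_assoc]

theorem sum_pathWeight_agree {A : Type*} [Fintype A] [DecidableEq A] {k : ℕ} (l : ℕ)
    (g : A → ℝ) (w : Fin k → A → A → ℝ) (c : Fin k → ℝ) (ys : Fin (k + 1) → A)
    (h : ∀ i : Fin k, l ≤ i → ∀ y, ((i : ℕ) = l → y = ys i.castSucc) → ∑ y', w i y y' = c i) :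
    ∑ ys', (if AgreeUpTo l ys' ys then pathWeight g w ys' else 0) =
      g (ys 0) * ∏ i : Fin k, if (i : ℕ) < l then w i (ys i.castSucc) (ys i.succ) else c i := by
  induction k with
  | zero =>
    rw [Finset.sum_eq_single ys]
    · rw [if_pos (show AgreeUpTo l ys ys from fun _ _ => rfl)]
      simp [pathWeight]
    · intro b _ hb
      rw [if_neg]
      intro hag
      exact hb (funext fun i => hag i (by omega))
    · simp
  | succ k ih =>
    rcases Nat.lt_or_ge k l with hl | hl
    · rw [Finset.sum_eq_single ys]
      · rw [if_pos (show AgreeUpTo l ys ys from fun _ _ => rfl), pathWeight]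
        congr 1
        exact Finset.prod_congr rfl fun i _ => by rw [if_pos (by omega)]
      · intro b _ hb
        rw [if_neg]
        intro hag
        exact hb (funext fun i => hag i (by omega))
      · simp
    · rw [sum_fin_snoc]
      have hag : ∀ (us : Fin (k + 1) → A) a,
          AgreeUpTo l (Fin.snoc us a : Fin (k + 2) → A) ys ↔
            AgreeUpTo l us (fun i => ys i.castSucc) := by
        intro us a
        constructor
        · intro H i hi
          have := H i.castSucc hi
          rwa [Fin.snoc_castSucc] at this
        · intro H i
          refine Fin.lastCases ?_ (fun j => ?_) i
          · intro hi
            simp only [Fin.val_last] at hi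
            omega
          · intro hj
            rw [Fin.snoc_castSucc]
            exact H j hj
      have key : ∀ us : Fin (k + 1) → A,
          (∑ a, if AgreeUpTo l (Fin.snoc us a : Fin (k + 2) → A) ys then
            pathWeight g w (Fin.snoc us a) else 0) =
          (if AgreeUpTo l us (fun i => ys i.castSucc) then
            pathWeight g (fun i => w i.castSucc) us else 0) * c (Fin.last k) := by
        intro us
        simp_rw [hag, pathWeight_snoc]
        split_ifs with H
        · rw [← Finset.mul_sum, h (Fin.last k) hl]
          intro hk
          exact H (Fin.last k) hk.le
        · simp
      simp_rw [key, ← Finset.sum_mul]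
      rw [ih _ (fun i => c i.castSucc) (fun i => ys i.castSucc)
          fun i hi => h i.castSucc hi,
        Fin.prod_univ_castSucc, if_neg (by simpa using hl), mul_assoc]
      rfl

/-- A Markovian coupling of two path laws is causal. -/
theorem isCausalFn_pathWeight {A B : Type*} [Fintype A] [Fintype B] [DecidableEq A]
    [DecidableEq B] {k : ℕ} (μ : A → ℝ) (m : A → A → ℝ) (hm : ∀ x, ∑ x', m x x' = 1)
    (γ : A → B → ℝ) (hγ : ∀ x, ∑ y, γ x y = μ x) (K : Fin k → A → B → A → B → ℝ)
    (hK : ∀ i x y x', ∑ y', K i x y x' y' = m x x') :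
    (∀ xs : Fin (k + 1) → A, ∑ ys : Fin (k + 1) → B, pathWeight (γ (xs 0))
      (fun i y y' => K i (xs i.castSucc) y (xs i.succ) y') ys = pathW μ m k xs) ∧
    IsCausalFn k (fun xs ys => pathWeight (γ (xs 0))
      (fun i y y' => K i (xs i.castSucc) y (xs i.succ) y') ys) := by
  have hmarg : ∀ xs : Fin (k + 1) → A, ∑ ys : Fin (k + 1) → B, pathWeight (γ (xs 0))
      (fun i y y' => K i (xs i.castSucc) y (xs i.succ) y') ys = pathW μ m k xs := by
    intro xs
    rw [sum_pathWeight _ _ (fun i => m (xs i.castSucc) (xs i.succ)) fun i y => hK i _ y _, hγ]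
    rfl
  have hfix : ∀ (l : ℕ) (xs : Fin (k + 1) → A) (ys : Fin (k + 1) → B),
      (∑ ys', if AgreeUpTo l ys' ys then pathWeight (γ (xs 0))
        (fun i y y' => K i (xs i.castSucc) y (xs i.succ) y') ys' else 0) =
      pathWeight (fun x => γ x (ys 0)) (fun i x x' => if (i : ℕ) < l then
        K i x (ys i.castSucc) x' (ys i.succ) else m x x') xs := by
    intro l xs ys
    rw [sum_pathWeight_agree l _ _ (fun i => m (xs i.castSucc) (xs i.succ)) ys
      fun i _ y _ => hK i _ y _]
    rfl
  refine ⟨hmarg, isCausalFn_iff.mpr fun l _ xs ys => ?_⟩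
  have e2 : (∑ xs' : Fin (k + 1) → A, ∑ ys' : Fin (k + 1) → B,
      if AgreeUpTo l xs' xs then pathWeight (γ (xs' 0))
        (fun i y y' => K i (xs' i.castSucc) y (xs' i.succ) y') ys' else 0) =
      μ (xs 0) * ∏ i : Fin k, if (i : ℕ) < l then m (xs i.castSucc) (xs i.succ) else 1 := by
    rw [← sum_pathWeight_agree l μ (fun _ => m) (fun _ => 1) xs fun i _ y _ => hm y]
    refine Finset.sum_congr rfl fun xs' _ => ?_
    split_ifs
    · exact hmarg xs'
    · simp
  have e3 : (∑ xs' : Fin (k + 1) → A, ∑ ys' : Fin (k + 1) → B,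
      if AgreeUpTo l xs' xs ∧ AgreeUpTo l ys' ys then pathWeight (γ (xs' 0))
        (fun i y y' => K i (xs' i.castSucc) y (xs' i.succ) y') ys' else 0) =
      γ (xs 0) (ys 0) * ∏ i : Fin k, if (i : ℕ) < l then
        K i (xs i.castSucc) (ys i.castSucc) (xs i.succ) (ys i.succ) else 1 := by
    have := sum_pathWeight_agree l (fun x => γ x (ys 0)) (fun i x x' => if (i : ℕ) < l then
        K i x (ys i.castSucc) x' (ys i.succ) else m x x') (fun _ => 1) xs (by
      intro i hi y _
      simp only [if_neg (not_lt.mpr hi), hm])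
    refine Eq.trans (Finset.sum_congr rfl fun xs' _ => ?_) (this.trans ?_)
    · rw [← hfix l xs' ys]
      by_cases h : AgreeUpTo l xs' xs <;> simp only [h, true_and, false_and, if_true, if_false,
        Finset.sum_const_zero]
    · congr 1
      refine Finset.prod_congr rfl fun i _ => ?_
      split_ifs <;> rfl
  rw [hmarg, hfix, e2, e3, pathWeight, pathW]
  rw [mul_mul_mul_comm, mul_mul_mul_comm _ _ (μ (xs 0)), ← Finset.prod_mul_distrib,
    ← Finset.prod_mul_distrib]
  congr 1
  refine Finset.prod_congr rfl fun i _ => ?_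
  split_ifs
  · rfl
  · ring

theorem pathWeight_odot {A B : Type*} [Fintype A] [Fintype B] {k : ℕ}
    (γ : A × B → ℝ) (ν : A × B → A × B → ℝ) (K : Fin k → A × B → A × B → ℝ)
    (zs : Fin (k + 1) → A × B) :
    pathWeight (odotFn ν γ) K zs = ∑ p, γ p * pathWeight (ν p) K zs := by
  simp only [pathWeight, odotFn, Finset.sum_mul, mul_assoc]

theorem odotFn_comp {A B : Type*} [Fintype A] [Fintype B] (γ : A × B → ℝ)
    (ν₁ ν' ν : A × B → A × B → ℝ) (h : ∀ p r, ν p r = ∑ s, ν₁ p s * ν' s r) :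
    odotFn ν γ = odotFn ν' (odotFn ν₁ γ) := by
  funext r
  simp only [odotFn, h, Finset.mul_sum, Finset.sum_mul]
  rw [Finset.sum_comm]
  simp only [mul_assoc]

theorem odotFn_id {A B : Type*} [Fintype A] [Fintype B] [DecidableEq A] [DecidableEq B]
    (γ : A × B → ℝ) (ν : A × B → A × B → ℝ) (h : ∀ p r, ν p r = if r = p then 1 else 0) :
    odotFn ν γ = γ := by
  funext r
  simp [odotFn, h]

/-- Final-time laws under a `k`-step coupling come from Markovian path weights. -/
theorem IsKStepCoupling.exists_pathWeight {A B : Type*} [Fintype A] [Fintype B]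
    [DecidableEq A] [DecidableEq B] {mA : A → A → ℝ} {mB : B → B → ℝ} {k : ℕ}
    {ν : A × B → A × B → ℝ} (hν : IsKStepCoupling mA mB k ν) :
    ∃ K : Fin k → A × B → A × B → ℝ, (∀ i, IsOneStepCoupling mA mB (K i)) ∧
      ∀ (γ f : A × B → ℝ), ∑ zs, pathWeight γ K zs * f (zs (Fin.last k)) =
        ∑ p, odotFn ν γ p * f p := by
  have base : ∀ γ f : A × B → ℝ, ∑ zs : Fin 1 → A × B,
      pathWeight γ (fun i : Fin 0 => i.elim0) zs * f (zs (Fin.last 0)) = ∑ p, γ p * f p := by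
    intro γ f
    rw [sum_fin_cons]
    simp [pathWeight]
  have step : ∀ (n : ℕ) (ν₁ : A × B → A × B → ℝ) (K : Fin n → A × B → A × B → ℝ)
      (γ f : A × B → ℝ), ∑ zs, pathWeight γ (Fin.cons ν₁ K : Fin (n + 1) → _) zs *
          f (zs (Fin.last (n + 1))) =
        ∑ zs, pathWeight (odotFn ν₁ γ) K zs * f (zs (Fin.last n)) := by
    intro n ν₁ K γ f
    rw [sum_fin_cons, Finset.sum_comm]
    refine Finset.sum_congr rfl fun us _ => ?_
    simp only [pathWeight_cons, pathWeight_odot, Finset.sum_mul, Fin.cons_zero, Fin.cons_succ,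
      ← Fin.succ_last]
  induction hν with
  | zero ν h =>
    exact ⟨fun i => i.elim0, fun i => i.elim0, fun γ f => by rw [base, odotFn_id γ ν h]⟩
  | one ν h =>
    refine ⟨Fin.cons ν fun i => i.elim0, fun i => ?_, fun γ f => by rw [step, base]⟩
    rw [Fin.fin_one_eq_zero i]
    exact h
  | succ k ν' ν₁ ν h' h₁ h ih =>
    obtain ⟨K, hK, hsum⟩ := ih
    refine ⟨Fin.cons ν₁ K, Fin.cases h₁ hK, fun γ f => ?_⟩
    rw [step, hsum, odotFn_comp γ ν₁ ν' ν h]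

theorem IsKStepCoupling.comp_right {A B : Type*} [Fintype A] [Fintype B]
    [DecidableEq A] [DecidableEq B] {mA : A → A → ℝ} {mB : B → B → ℝ} {k : ℕ}
    {ν' ν₁ : A × B → A × B → ℝ} (hν : IsKStepCoupling mA mB k ν')
    (h₁ : IsOneStepCoupling mA mB ν₁) :
    IsKStepCoupling mA mB (k + 1) (fun p r => ∑ s, ν' p s * ν₁ s r) := by
  induction hν with
  | zero ν h =>
    convert IsKStepCoupling.one ν₁ h₁ using 3
    simp [h]
  | one ν h => exact .succ 1 ν₁ ν _ (.one ν₁ h₁) h fun _ _ => rfl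
  | succ k ν' ν₀ ν h' h₀ h ih =>
    refine .succ (k + 1) _ ν₀ _ ih h₀ fun p r => ?_
    simp only [h, Finset.sum_mul, Finset.mul_sum]
    rw [Finset.sum_comm]
    simp only [mul_assoc]

theorem sum_eq_of_fiber_sum_eq {S T : Type*} [Fintype S] [Fintype T] [DecidableEq T]
    (q : S → T) (F G : S → ℝ)
    (h : ∀ s, ∑ s', (if q s' = q s then F s' else 0) = ∑ s', if q s' = q s then G s' else 0) :
    ∑ s, F s = ∑ s, G s := by
  rw [← Finset.sum_fiberwise Finset.univ q F, ← Finset.sum_fiberwise Finset.univ q G]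
  refine Finset.sum_congr rfl fun u _ => ?_
  simp only [Finset.sum_filter]
  by_cases hu : ∃ s, q s = u
  · obtain ⟨s, rfl⟩ := hu
    exact h s
  · push Not at hu
    simp [hu]

/-- Under a causal coupling, the next state of the first chain, given the past of both chains,
follows the kernel of the first chain. -/
theorem IsCausalFn.sum_next_agree {A B : Type*} [Fintype A] [Fintype B] [DecidableEq A]
    [DecidableEq B] {k : ℕ} {π : (Fin (k + 1) → A) → (Fin (k + 1) → B) → ℝ}
    (hc : IsCausalFn k π) (h0 : ∀ xs ys, 0 ≤ π xs ys) {μ : A → ℝ} {m : A → A → ℝ}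
    (hm : ∀ x, ∑ x', m x x' = 1) (hπ : ∀ xs, ∑ ys, π xs ys = pathW μ m k xs)
    (t : Fin k) (x' : A) (xs : Fin (k + 1) → A) (ys : Fin (k + 1) → B) :
    (∑ xs', ∑ ys', if AgreeUpTo t xs' xs ∧ AgreeUpTo t ys' ys then
      (if xs' t.succ = x' then π xs' ys' else 0) else 0) =
    m (xs t.castSucc) x' *
      ∑ xs', ∑ ys', if AgreeUpTo t xs' xs ∧ AgreeUpTo t ys' ys then π xs' ys' else 0 := by
  set a := ∑ xs' : Fin (k + 1) → A, ∑ ys' : Fin (k + 1) → B,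
    if AgreeUpTo t xs' xs then π xs' ys' else 0 with ha
  set Q := ∑ xs' : Fin (k + 1) → A, ∑ ys' : Fin (k + 1) → B,
    if AgreeUpTo t xs' xs ∧ AgreeUpTo t ys' ys then π xs' ys' else 0 with hQ
  have hQ0 : 0 ≤ Q := Finset.sum_nonneg fun _ _ => Finset.sum_nonneg fun _ _ => by
    split_ifs <;> simp [h0]
  have hQa : Q ≤ a := Finset.sum_le_sum fun _ _ => Finset.sum_le_sum fun _ _ => by
    split_ifs <;> simp_all
  have hL0 : 0 ≤ (∑ xs', ∑ ys', if AgreeUpTo t xs' xs ∧ AgreeUpTo t ys' ys then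
      (if xs' t.succ = x' then π xs' ys' else 0) else 0) :=
    Finset.sum_nonneg fun _ _ => Finset.sum_nonneg fun _ _ => by
      split_ifs <;> simp [h0]
  have hLQ : (∑ xs', ∑ ys', if AgreeUpTo t xs' xs ∧ AgreeUpTo t ys' ys then
      (if xs' t.succ = x' then π xs' ys' else 0) else 0) ≤ Q :=
    Finset.sum_le_sum fun _ _ => Finset.sum_le_sum fun _ _ => by
      split_ifs <;> simp [h0]
  rcases eq_or_ne a 0 with haz | haz
  · have hQz : Q = 0 := le_antisymm (haz ▸ hQa) hQ0
    rw [hQz, mul_zero]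
    exact le_antisymm (hQz ▸ hLQ) hL0
  have ha' : a = μ (xs 0) *
      ∏ i : Fin k, if (i : ℕ) < t then m (xs i.castSucc) (xs i.succ) else 1 := by
    rw [ha, ← sum_pathWeight_agree t μ (fun _ => m) (fun _ => 1) xs fun i _ y _ => hm y]
    refine Finset.sum_congr rfl fun xs' _ => ?_
    split_ifs
    · exact hπ xs'
    · simp
  have hnext : (∑ xs' : Fin (k + 1) → A, if AgreeUpTo t xs' xs then
      (if xs' t.succ = x' then pathW μ m k xs' else 0) else 0) = a * m (xs t.castSucc) x' := by
    have := sum_pathWeight_agree t μ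
      (fun i y y' => if i = t then (if y' = x' then m y y' else 0) else m y y')
      (fun i => if i = t then m (xs t.castSucc) x' else 1) xs (by
        intro i _ y hy
        by_cases hi : i = t
        · subst hi
          simp [hy rfl]
        · simp [hi, hm])
    refine Eq.trans (Finset.sum_congr rfl fun xs' _ => ?_) (this.trans ?_)
    · congr 1
      rw [pathW, pathWeight]
      split_ifs with h
      · congr 1
        refine Finset.prod_congr rfl fun i _ => ?_
        by_cases hi : i = t
        · subst hi
          simp [h]
        · simp [hi]
      · rw [Finset.prod_eq_zero (Finset.mem_univ t) (by simp [h]), mul_zero]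
    · have hlast : m (xs t.castSucc) x' =
          ∏ i : Fin k, if i = t then m (xs t.castSucc) x' else 1 := by simp
      rw [ha', mul_assoc, hlast, ← Finset.prod_mul_distrib, ← hlast]
      congr 1
      refine Finset.prod_congr rfl fun i _ => ?_
      by_cases hi : i = t
      · simp [hi]
      · simp [hi]
  refine mul_right_cancel₀ haz ?_
  clear_value a Q
  rw [mul_assoc, mul_comm (m _ _), mul_assoc, ← hnext, Finset.mul_sum, Finset.sum_mul]
  refine Finset.sum_congr rfl fun xs' _ => ?_
  by_cases h1 : AgreeUpTo t xs' xs
  · by_cases h2 : xs' t.succ = x'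
    · have := isCausalFn_iff.mp hc t t.is_lt.le xs' ys
      simp only [h1.congr_right, ← ha, ← hQ] at this
      simp only [h1, h2, true_and, if_true, ← hπ]
      exact this
    · simp [h2]
  · simp [h1]

theorem IsCausalFn.sum_next {A B : Type*} [Fintype A] [Fintype B] [DecidableEq A]
    [DecidableEq B] {k : ℕ} {π : (Fin (k + 1) → A) → (Fin (k + 1) → B) → ℝ}
    (hc : IsCausalFn k π) (h0 : ∀ xs ys, 0 ≤ π xs ys) {μ : A → ℝ} {m : A → A → ℝ}
    (hm : ∀ x, ∑ x', m x x' = 1) (hπ : ∀ xs, ∑ ys, π xs ys = pathW μ m k xs)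
    (t : Fin k) (x x' : A) (y : B) :
    (∑ xs, ∑ ys, if xs t.castSucc = x ∧ ys t.castSucc = y ∧ xs t.succ = x'
      then π xs ys else 0) =
    m x x' * ∑ xs, ∑ ys, if xs t.castSucc = x ∧ ys t.castSucc = y then π xs ys else 0 := by
  rw [Finset.mul_sum]
  simp_rw [Finset.mul_sum]
  rw [← Fintype.sum_prod_type', ← Fintype.sum_prod_type']
  let q : (Fin (k + 1) → A) × (Fin (k + 1) → B) →
      ({i : Fin (k + 1) // (i : ℕ) ≤ t} → A) × ({i : Fin (k + 1) // (i : ℕ) ≤ t} → B) :=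
    fun s => (fun i => s.1 i, fun i => s.2 i)
  have hq : ∀ s' s, q s' = q s ↔ AgreeUpTo t s'.1 s.1 ∧ AgreeUpTo t s'.2 s.2 := by
    intro s' s
    simp only [q, Prod.mk.injEq, funext_iff, Subtype.forall, AgreeUpTo]
  refine sum_eq_of_fiber_sum_eq q _ _ fun s => ?_
  simp only [hq]
  rw [Fintype.sum_prod_type, Fintype.sum_prod_type]
  have key := hc.sum_next_agree h0 hm hπ t x' s.1 s.2
  rw [Finset.mul_sum] at key
  simp_rw [Finset.mul_sum] at key
  by_cases hs : s.1 t.castSucc = x ∧ s.2 t.castSucc = y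
  · obtain ⟨rfl, rfl⟩ := hs
    refine Eq.trans ?_ (key.trans ?_)
    all_goals
      refine Finset.sum_congr rfl fun xs' _ => Finset.sum_congr rfl fun ys' _ => ?_
      by_cases h : AgreeUpTo t xs' s.1 ∧ AgreeUpTo t ys' s.2
      · have e1 := h.1 t.castSucc le_rfl
        have e2 := h.2 t.castSucc le_rfl
        simp [h, e1, e2]
      · simp [h]
  · refine Finset.sum_congr rfl fun xs' _ => Finset.sum_congr rfl fun ys' _ => ?_
    by_cases h : AgreeUpTo t xs' s.1 ∧ AgreeUpTo t ys' s.2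
    · have e1 := h.1 t.castSucc le_rfl
      have e2 := h.2 t.castSucc le_rfl
      have hs' : ¬ (s.1 t.castSucc = x ∧ s.2 t.castSucc = y ∧ xs' t.succ = x') :=
        fun H => hs ⟨H.1, H.2.1⟩
      simp [e1, e2, hs, hs']
    · simp [h]

/-- The law of the pair of states at time `i` under a coupling of path laws. -/
def pairLaw {A B : Type*} [Fintype A] [Fintype B] [DecidableEq A] [DecidableEq B] {k : ℕ}
    (π : (Fin (k + 1) → A) → (Fin (k + 1) → B) → ℝ) (i : Fin (k + 1)) (p : A × B) : ℝ :=
  ∑ xs, ∑ ys, if xs i = p.1 ∧ ys i = p.2 then π xs ys else 0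

/-- The joint law of the pairs of states at times `t` and `t + 1`. -/
def stepLaw {A B : Type*} [Fintype A] [Fintype B] [DecidableEq A] [DecidableEq B] {k : ℕ}
    (π : (Fin (k + 1) → A) → (Fin (k + 1) → B) → ℝ) (t : Fin k) (p r : A × B) : ℝ :=
  ∑ xs, ∑ ys, if xs t.castSucc = p.1 ∧ ys t.castSucc = p.2 ∧ xs t.succ = r.1 ∧ ys t.succ = r.2
    then π xs ys else 0

section Markov

variable {A B : Type*} [Fintype A] [Fintype B] [DecidableEq A] [DecidableEq B] {k : ℕ}
  {π : (Fin (k + 1) → A) → (Fin (k + 1) → B) → ℝ}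

theorem sum_sum_sum_comm {S T U : Type*} [Fintype S] [Fintype T] [Fintype U]
    (f : S → T → U → ℝ) : ∑ u, ∑ s, ∑ t, f s t u = ∑ s, ∑ t, ∑ u, f s t u := by
  rw [Finset.sum_comm]
  exact Finset.sum_congr rfl fun _ _ => Finset.sum_comm

theorem sum_stepLaw_snd (t : Fin k) (p : A × B) (x' : A) :
    ∑ y', stepLaw π t p (x', y') = ∑ xs, ∑ ys,
      if xs t.castSucc = p.1 ∧ ys t.castSucc = p.2 ∧ xs t.succ = x' then π xs ys else 0 := by
  simp only [stepLaw]
  rw [sum_sum_sum_comm]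
  simp only [← and_assoc]
  simp only [ite_and]
  simp

theorem sum_stepLaw_fst (t : Fin k) (p : A × B) (y' : B) :
    ∑ x', stepLaw π t p (x', y') = ∑ ys, ∑ xs,
      if ys t.castSucc = p.2 ∧ xs t.castSucc = p.1 ∧ ys t.succ = y' then π xs ys else 0 := by
  simp only [stepLaw]
  rw [sum_sum_sum_comm, Finset.sum_comm]
  refine Finset.sum_congr rfl fun ys _ => Finset.sum_congr rfl fun xs _ => ?_
  rw [Finset.sum_eq_single (xs t.succ)]
  · congr 1
    simp only [true_and]
    exact propext and_left_comm
  · intro b _ hb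
    simp [hb.symm]
  · simp

theorem sum_stepLaw_left (t : Fin k) (r : A × B) :
    ∑ p, stepLaw π t p r = pairLaw π t.succ r := by
  simp only [stepLaw, pairLaw]
  rw [sum_sum_sum_comm]
  refine Finset.sum_congr rfl fun xs _ => Finset.sum_congr rfl fun ys _ => ?_
  rw [Finset.sum_eq_single (xs t.castSucc, ys t.castSucc)]
  · simp
  · intro b _ hb
    rw [if_neg]
    rintro ⟨h1, h2, _⟩
    exact hb (Prod.ext h1.symm h2.symm)
  · simp

theorem stepLaw_nonneg (h0 : ∀ xs ys, 0 ≤ π xs ys) (t : Fin k) (p r : A × B) :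
    0 ≤ stepLaw π t p r :=
  Finset.sum_nonneg fun _ _ => Finset.sum_nonneg fun _ _ => by split_ifs <;> simp [h0]

theorem pairLaw_nonneg (h0 : ∀ xs ys, 0 ≤ π xs ys) (i : Fin (k + 1)) (p : A × B) :
    0 ≤ pairLaw π i p :=
  Finset.sum_nonneg fun _ _ => Finset.sum_nonneg fun _ _ => by split_ifs <;> simp [h0]

theorem stepLaw_le (h0 : ∀ xs ys, 0 ≤ π xs ys) (t : Fin k) (p r : A × B) :
    stepLaw π t p r ≤ pairLaw π t.castSucc p :=
  Finset.sum_le_sum fun _ _ => Finset.sum_le_sum fun _ _ => by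
    split_ifs <;> simp_all

theorem sum_pairLaw_mul (i : Fin (k + 1)) (f : A × B → ℝ) :
    ∑ p, pairLaw π i p * f p = ∑ xs, ∑ ys, π xs ys * f (xs i, ys i) := by
  simp only [pairLaw, Finset.sum_mul]
  rw [sum_sum_sum_comm]
  refine Finset.sum_congr rfl fun xs _ => Finset.sum_congr rfl fun ys _ => ?_
  rw [Finset.sum_eq_single (xs i, ys i)]
  · simp
  · intro b _ hb
    rw [if_neg, zero_mul]
    rintro ⟨h1, h2⟩
    exact hb (Prod.ext h1.symm h2.symm)
  · simp

theorem sum_pathW_zero {μ : A → ℝ} {m : A → A → ℝ} (hm : ∀ x, ∑ x', m x x' = 1) (x : A) :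
    (∑ xs : Fin (k + 1) → A, if xs 0 = x then pathW μ m k xs else 0) = μ x := by
  have := sum_pathWeight (k := k) (fun z => if z = x then μ z else 0) (fun _ => m)
    (fun _ => 1) fun _ => hm
  simp only [pathWeight, ite_mul, zero_mul] at this
  refine Eq.trans this ?_
  simp

theorem isCouplingFn_pairLaw_zero (h0 : ∀ xs ys, 0 ≤ π xs ys) {μA : A → ℝ} {mA : A → A → ℝ}
    {μB : B → ℝ} {mB : B → B → ℝ} (hmA : ∀ x, ∑ x', mA x x' = 1)
    (hmB : ∀ y, ∑ y', mB y y' = 1) (hA : ∀ xs, ∑ ys, π xs ys = pathW μA mA k xs)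
    (hB : ∀ ys, ∑ xs, π xs ys = pathW μB mB k ys) :
    IsCouplingFn (pairLaw π 0) μA μB := by
  refine ⟨pairLaw_nonneg h0 0, fun x => ?_, fun y => ?_⟩
  · rw [← sum_pathW_zero (k := k) (μ := μA) hmA x]
    simp only [pairLaw, ← hA]
    rw [sum_sum_sum_comm]
    refine Finset.sum_congr rfl fun xs _ => ?_
    simp only [ite_and]
    split_ifs <;> simp
  · rw [← sum_pathW_zero (k := k) (μ := μB) hmB y]
    simp only [pairLaw, ← hB]
    rw [sum_sum_sum_comm, Finset.sum_comm]
    refine Finset.sum_congr rfl fun ys _ => ?_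
    simp only [ite_and]
    split_ifs <;> simp

/-- The transition from time `t` to time `t + 1` of the Markovian projection of `π`. -/
noncomputable def markovStep (mA : A → A → ℝ) (mB : B → B → ℝ)
    (π : (Fin (k + 1) → A) → (Fin (k + 1) → B) → ℝ) (t : Fin k) (p r : A × B) : ℝ :=
  if pairLaw π t.castSucc p = 0 then mA p.1 r.1 * mB p.2 r.2
  else stepLaw π t p r / pairLaw π t.castSucc p

theorem isOneStepCoupling_markovStep (h0 : ∀ xs ys, 0 ≤ π xs ys) {μA : A → ℝ}
    {mA : A → A → ℝ} {μB : B → ℝ} {mB : B → B → ℝ} (hmA0 : ∀ x x', 0 ≤ mA x x')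
    (hmA : ∀ x, ∑ x', mA x x' = 1) (hmB0 : ∀ y y', 0 ≤ mB y y')
    (hmB : ∀ y, ∑ y', mB y y' = 1) (hA : ∀ xs, ∑ ys, π xs ys = pathW μA mA k xs)
    (hB : ∀ ys, ∑ xs, π xs ys = pathW μB mB k ys) (hc : IsCausalFn k π)
    (hc' : IsCausalFn k fun ys xs => π xs ys) (t : Fin k) :
    IsOneStepCoupling mA mB (markovStep mA mB π t) := by
  intro p
  by_cases hp : pairLaw π t.castSucc p = 0
  · simp only [IsCouplingFn, markovStep, hp, if_true]
    refine ⟨fun r => mul_nonneg (hmA0 _ _) (hmB0 _ _), fun x => ?_, fun y => ?_⟩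
    · rw [← Finset.mul_sum, hmB, mul_one]
    · rw [← Finset.sum_mul, hmA, one_mul]
  · simp only [IsCouplingFn, markovStep, hp, if_false]
    refine ⟨fun r => div_nonneg (stepLaw_nonneg h0 t p r) (pairLaw_nonneg h0 _ p),
      fun x => ?_, fun y => ?_⟩
    · rw [← Finset.sum_div, div_eq_iff hp, sum_stepLaw_snd, hc.sum_next h0 hmA hA]
      rfl
    · rw [← Finset.sum_div, div_eq_iff hp, sum_stepLaw_fst,
        hc'.sum_next (fun ys xs => h0 xs ys) hmB hB, Finset.sum_comm]
      simp only [pairLaw, and_comm]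

theorem odotFn_markovStep (h0 : ∀ xs ys, 0 ≤ π xs ys) (mA : A → A → ℝ) (mB : B → B → ℝ)
    (t : Fin k) :
    odotFn (markovStep mA mB π t) (pairLaw π t.castSucc) = pairLaw π t.succ := by
  funext r
  rw [odotFn, ← sum_stepLaw_left]
  refine Finset.sum_congr rfl fun p _ => ?_
  rw [markovStep]
  split_ifs with hp
  · rw [hp, zero_mul]
    exact le_antisymm (stepLaw_nonneg h0 t p r) (hp ▸ stepLaw_le h0 t p r)
  · exact mul_div_cancel₀ _ hp

theorem exists_isKStepCoupling_pairLaw (h0 : ∀ xs ys, 0 ≤ π xs ys) {mA : A → A → ℝ}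
    {mB : B → B → ℝ} (hstep : ∀ t, IsOneStepCoupling mA mB (markovStep mA mB π t))
    (i : Fin (k + 1)) :
    ∃ ν, IsKStepCoupling mA mB i ν ∧ odotFn ν (pairLaw π 0) = pairLaw π i := by
  induction i using Fin.induction with
  | zero => exact ⟨_, .zero _ fun _ _ => rfl, odotFn_id _ _ fun _ _ => rfl⟩
  | succ t ih =>
    obtain ⟨ν, hν, hlaw⟩ := ih
    refine ⟨_, hν.comp_right (hstep t), ?_⟩
    rw [odotFn_comp _ ν (markovStep mA mB π t) _ fun _ _ => rfl, hlaw, odotFn_markovStep h0]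

end Markov

/-- `d_WL^{(k)} = d^{c^k}(α^k, β^k)`. -/
theorem dWL_eq_bicausal_OT {X Y Z : Type*} [Fintype X] [Fintype Y]
    [DecidableEq X] [DecidableEq Y] [PseudoMetricSpace Z] (k : ℕ)
    (μX : X → ℝ) (mX : X → X → ℝ) (lX : X → Z)
    (μY : Y → ℝ) (mY : Y → Y → ℝ) (lY : Y → Z)
    (hμX0 : ∀ x, 0 ≤ μX x) (hμX1 : ∑ x, μX x = 1)
    (hmX0 : ∀ x x', 0 ≤ mX x x') (hmX1 : ∀ x, ∑ x', mX x x' = 1)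
    (hsX : ∀ x', ∑ x, μX x * mX x x' = μX x')
    (hμY0 : ∀ y, 0 ≤ μY y) (hμY1 : ∑ y, μY y = 1)
    (hmY0 : ∀ y y', 0 ≤ mY y y') (hmY1 : ∀ y, ∑ y', mY y y' = 1)
    (hsY : ∀ y', ∑ y, μY y * mY y y' = μY y') :
    dWL k mX μX lX mY μY lY = dBC k mX μX lX mY μY lY := by
  rw [dWL, dBC]
  congr 1
  ext r
  constructor
  · rintro ⟨γ, ν, ⟨hγ0, hγX, hγY⟩, hν, rfl⟩
    obtain ⟨K, hK, hsum⟩ := hν.exists_pathWeight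
    have hX := isCausalFn_pathWeight μX mX hmX1 (fun x y => γ (x, y)) hγX
      (fun i x y x' y' => K i (x, y) (x', y')) fun i x y => (hK i (x, y)).2.1
    have hY := isCausalFn_pathWeight μY mY hmY1 (fun y x => γ (x, y)) hγY
      (fun i y x y' x' => K i (x, y) (x', y')) fun i y x => (hK i (x, y)).2.2
    refine ⟨fun xs ys => pathWeight γ K fun i => (xs i, ys i), fun xs ys => ?_,
      hX.1, hY.1, hX.2, hY.2, ?_⟩
    · exact mul_nonneg (hγ0 _) (Finset.prod_nonneg fun i _ => (hK i _).1 _)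
    · rw [← hsum γ fun p => dist (lX p.1) (lY p.2),
        ← (Equiv.arrowProdEquivProdArrow (Fin (k + 1)) (fun _ => X) fun _ => Y).symm.sum_comp,
        Fintype.sum_prod_type]
      rfl
  · rintro ⟨π, h0, hX, hY, hc, hc', rfl⟩
    obtain ⟨ν, hν, hlaw⟩ := exists_isKStepCoupling_pairLaw h0
      (isOneStepCoupling_markovStep h0 hmX0 hmX1 hmY0 hmY1 hX hY hc hc') (Fin.last k)
    refine ⟨pairLaw π 0, ν, isCouplingFn_pairLaw_zero h0 hmX1 hmY1 hX hY, hν, ?_⟩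
    rw [hlaw, sum_pairLaw_mul (Fin.last k) fun p => dist (lX p.1) (lY p.2)]
end

section
/- Let (𝒳,ℓ_X) and (𝒴,ℓ_Y) be Z-labeled measure Markov chains on finite state spaces with injective label maps ℓ_X and ℓ_Y, and let k ∈ ℕ. Then the pushforward map (ℓ_X^{k+1}×ℓ_Y^{k+1})_# maps the set C_bc(α^k,β^k) of bicausal couplings between α^k and β^k onto the set C_bc(α_Z^k,β_Z^k) of bicausal couplings between α_Z^k := (ℓ_X^{k+1})_# α^k and β_Z^k := (ℓ_Y^{k+1})_# β^k; that is, the pushforward of every bicausal coupling is bicausal, and every bicausal coupling between α_Z^k and β_Z^k arises in this way. -/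
/-!
STATEMENT 7: Let `(𝒳,ℓ_X)` and `(𝒴,ℓ_Y)` be Z-labeled measure Markov chains on finite state
spaces with injective label maps, and `k ∈ ℕ`. Then the pushforward map
`(ℓ_X^{k+1} × ℓ_Y^{k+1})_#` maps the set of bicausal couplings between `α^k` and `β^k`
onto the set of bicausal couplings between `α_Z^k := (ℓ_X^{k+1})_# α^k` and
`β_Z^k := (ℓ_Y^{k+1})_# β^k` (stated below as an equality of image sets: the pushforward of
every bicausal coupling is bicausal, and every bicausal coupling between `α_Z^k` and
`β_Z^k` arises in this way).
-/

open Finset MeasureTheory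

noncomputable section

/-- The path law `α^k` as a measure on `A^{k+1}`. -/
def pathMeas {A : Type*} [Fintype A] [DecidableEq A] [MeasurableSpace A]
    (μ : A → ℝ) (m : A → A → ℝ) (k : ℕ) : Measure (Fin (k + 1) → A) :=
  ∑ xs : Fin (k + 1) → A, ENNReal.ofReal (pathW μ m k xs) • Measure.dirac xs

/-- Causality of a coupling measure `π` of two laws on path spaces `C^{k+1}` and `D^{k+1}`,
from the first to the second factor: for all `0 ≤ l ≤ k`,
`π((d_0,…,d_l) | (c_0,…,c_k)) = π((d_0,…,d_l) | (c_0,…,c_l))`, written multiplicatively (so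
that it is exactly the conditional-probability statement whenever the conditioning events
are non-null). -/
def IsCausalM {C D : Type*} [MeasurableSpace C] [MeasurableSpace D] (k : ℕ)
    (π : Measure ((Fin (k + 1) → C) × (Fin (k + 1) → D))) : Prop :=
  ∀ l ≤ k, ∀ (cs : Fin (k + 1) → C) (ds : Fin (k + 1) → D),
    π {p | p.1 = cs ∧ ∀ i : Fin (k + 1), (i : ℕ) ≤ l → p.2 i = ds i} *
      π {p | ∀ i : Fin (k + 1), (i : ℕ) ≤ l → p.1 i = cs i} =
    π {p | (∀ i : Fin (k + 1), (i : ℕ) ≤ l → p.1 i = cs i) ∧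
           (∀ i : Fin (k + 1), (i : ℕ) ≤ l → p.2 i = ds i)} *
      π {p | p.1 = cs}

/-- Bicausal couplings between laws `α` on `C^{k+1}` and `β` on `D^{k+1}`: couplings that
are causal in both directions. -/
def IsBicausalCoupling {C D : Type*} [MeasurableSpace C] [MeasurableSpace D] (k : ℕ)
    (α : Measure (Fin (k + 1) → C)) (β : Measure (Fin (k + 1) → D))
    (π : Measure ((Fin (k + 1) → C) × (Fin (k + 1) → D))) : Prop :=
  π.map Prod.fst = α ∧ π.map Prod.snd = β ∧
  IsCausalM k π ∧ IsCausalM k (π.map Prod.swap)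

end

theorem measurableEmbedding_of_finite {A B : Type*} [Finite A] [MeasurableSpace A]
    [DiscreteMeasurableSpace A] [MeasurableSpace B] [MeasurableSingletonClass B] {f : A → B}
    (hf : Function.Injective f) : MeasurableEmbedding f :=
  ⟨hf, .of_discrete, fun _ _ => (Set.toFinite _).measurableSet⟩

/-- Causality is invariant under relabeling both factors along injective maps. -/
theorem isCausalM_map_iff {C D E F : Type*} [MeasurableSpace C] [MeasurableSpace D]
    [MeasurableSpace E] [MeasurableSpace F] {k : ℕ} {f : C → E} {g : D → F}
    (hf : Function.Injective f) (hg : Function.Injective g)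
    (hfg : MeasurableEmbedding fun p : (Fin (k + 1) → C) × (Fin (k + 1) → D) =>
      ((fun i => f (p.1 i), fun i => g (p.2 i)) : (Fin (k + 1) → E) × (Fin (k + 1) → F)))
    (π : Measure ((Fin (k + 1) → C) × (Fin (k + 1) → D))) :
    IsCausalM k (π.map fun p => (fun i => f (p.1 i), fun i => g (p.2 i))) ↔ IsCausalM k π := by
  have hpath (u v : Fin (k + 1) → C) : (fun i => f (u i)) = (fun i => f (v i)) ↔ u = v :=
    hf.comp_left.eq_iff
  unfold IsCausalM
  simp only [hfg.map_apply, Set.preimage_ofPred_eq]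
  refine ⟨fun h l hl cs ds => ?_, fun h l hl cs ds => ?_⟩
  · simpa only [hpath, hf.eq_iff, hg.eq_iff] using
      h l hl (fun i => f (cs i)) (fun i => g (ds i))
  by_cases hc : ∃ xs : Fin (k + 1) → C, (fun i => f (xs i)) = cs
  swap
  · have hempty (x : Fin (k + 1) → C) : (fun i => f (x i)) ≠ cs := fun hx => hc ⟨x, hx⟩
    simp [hempty]
  obtain ⟨xs, rfl⟩ := hc
  by_cases hd : ∃ ys : Fin (k + 1) → D, ∀ i : Fin (k + 1), (i : ℕ) ≤ l → g (ys i) = ds i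
  swap
  · have hempty (y : Fin (k + 1) → D) :
        ¬ ∀ i : Fin (k + 1), (i : ℕ) ≤ l → g (y i) = ds i := fun hy => hd ⟨y, hy⟩
    simp only [hempty, and_false, Set.ofPred_false, measure_empty, zero_mul]
  obtain ⟨ys, hys⟩ := hd
  have hprefix (y : Fin (k + 1) → D) :
      (∀ i : Fin (k + 1), (i : ℕ) ≤ l → g (y i) = ds i) ↔
        ∀ i : Fin (k + 1), (i : ℕ) ≤ l → y i = ys i :=
    forall₂_congr fun i hi => by rw [← hys i hi, hg.eq_iff]
  simpa only [hpath, hprefix, hf.eq_iff] using h l hl xs ys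

/-- Bicausal couplings are preserved and reflected by relabeling along injective maps. -/
theorem isBicausalCoupling_map_iff {C D E : Type*} [Finite C] [Finite D] [MeasurableSpace C]
    [DiscreteMeasurableSpace C] [MeasurableSpace D] [DiscreteMeasurableSpace D]
    [MeasurableSpace E] [MeasurableSingletonClass E] {k : ℕ} {f : C → E} {g : D → E}
    (hf : Function.Injective f) (hg : Function.Injective g)
    (α : Measure (Fin (k + 1) → C)) (β : Measure (Fin (k + 1) → D))
    (π : Measure ((Fin (k + 1) → C) × (Fin (k + 1) → D))) :
    IsBicausalCoupling k (α.map fun xs i => f (xs i)) (β.map fun ys i => g (ys i))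
        (π.map fun p => (fun i => f (p.1 i), fun i => g (p.2 i))) ↔
      IsBicausalCoupling k α β π := by
  have hF : MeasurableEmbedding fun (xs : Fin (k + 1) → C) i => f (xs i) :=
    measurableEmbedding_of_finite hf.comp_left
  have hG : MeasurableEmbedding fun (ys : Fin (k + 1) → D) i => g (ys i) :=
    measurableEmbedding_of_finite hg.comp_left
  have hFG : MeasurableEmbedding fun p : (Fin (k + 1) → C) × (Fin (k + 1) → D) =>
      ((fun i => f (p.1 i), fun i => g (p.2 i)) : (Fin (k + 1) → E) × (Fin (k + 1) → E)) :=
    hF.prodMap hG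
  have hGF : MeasurableEmbedding fun p : (Fin (k + 1) → D) × (Fin (k + 1) → C) =>
      ((fun i => g (p.1 i), fun i => f (p.2 i)) : (Fin (k + 1) → E) × (Fin (k + 1) → E)) :=
    hG.prodMap hF
  have hfst : (π.map fun p => (fun i => f (p.1 i), fun i => g (p.2 i))).map Prod.fst =
      (π.map Prod.fst).map fun xs i => f (xs i) := by
    rw [Measure.map_map measurable_fst hFG.measurable,
      Measure.map_map hF.measurable measurable_fst]
    rfl
  have hsnd : (π.map fun p => (fun i => f (p.1 i), fun i => g (p.2 i))).map Prod.snd =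
      (π.map Prod.snd).map fun ys i => g (ys i) := by
    rw [Measure.map_map measurable_snd hFG.measurable,
      Measure.map_map hG.measurable measurable_snd]
    rfl
  have hswap : (π.map fun p => (fun i => f (p.1 i), fun i => g (p.2 i))).map Prod.swap =
      (π.map Prod.swap).map fun p => (fun i => g (p.1 i), fun i => f (p.2 i)) := by
    rw [Measure.map_map measurable_swap hFG.measurable,
      Measure.map_map hGF.measurable measurable_swap]
    rfl
  have hFinj : Function.Injective (Measure.map fun (xs : Fin (k + 1) → C) i => f (xs i)) :=
    Function.LeftInverse.injective hF.comap_map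
  have hGinj : Function.Injective (Measure.map fun (ys : Fin (k + 1) → D) i => g (ys i)) :=
    Function.LeftInverse.injective hG.comap_map
  rw [IsBicausalCoupling, IsBicausalCoupling, hfst, hsnd, hswap, hFinj.eq_iff, hGinj.eq_iff,
    isCausalM_map_iff hf hg hFG, isCausalM_map_iff hg hf hGF]

/-- A measure on a product whose marginals are pushforwards along measurable embeddings is
itself a pushforward along the product embedding. -/
theorem exists_map_prodMap_eq {A B A' B' : Type*} [MeasurableSpace A] [MeasurableSpace B]
    [MeasurableSpace A'] [MeasurableSpace B'] {f : A → A'} {g : B → B'}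
    (hf : MeasurableEmbedding f) (hg : MeasurableEmbedding g)
    {α : Measure A} {β : Measure B} {ρ : Measure (A' × B')}
    (hfst : ρ.map Prod.fst = α.map f) (hsnd : ρ.map Prod.snd = β.map g) :
    ∃ π : Measure (A × B), π.map (Prod.map f g) = ρ := by
  refine ⟨ρ.comap (Prod.map f g), ?_⟩
  rw [(hf.prodMap hg).map_comap, Set.range_prodMap]
  have h₁ : ∀ᵐ p ∂ρ, p.1 ∈ Set.range f :=
    ae_of_ae_map measurable_fst.aemeasurable
      (hfst ▸ hf.ae_map_iff.2 (.of_forall Set.mem_range_self))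
  have h₂ : ∀ᵐ p ∂ρ, p.2 ∈ Set.range g :=
    ae_of_ae_map measurable_snd.aemeasurable
      (hsnd ▸ hg.ae_map_iff.2 (.of_forall Set.mem_range_self))
  refine Measure.restrict_eq_self_of_ae_mem ?_
  filter_upwards [h₁, h₂] with p hp₁ hp₂ using ⟨hp₁, hp₂⟩

/-- for injective label maps, the pushforward `(ℓ_X^{k+1} × ℓ_Y^{k+1})_#`
maps `C_bc(α^k, β^k)` onto `C_bc(α_Z^k, β_Z^k)`. -/
theorem pushforward_bicausal_surjective {X Y Z : Type*} [Fintype X] [Fintype Y]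
    [DecidableEq X] [DecidableEq Y]
    [MeasurableSpace X] [DiscreteMeasurableSpace X]
    [MeasurableSpace Y] [DiscreteMeasurableSpace Y]
    [MetricSpace Z] [MeasurableSpace Z] [MeasurableSingletonClass Z] (k : ℕ)
    (μX : X → ℝ) (mX : X → X → ℝ) (lX : X → Z)
    (μY : Y → ℝ) (mY : Y → Y → ℝ) (lY : Y → Z)
    (hlX : Function.Injective lX) (hlY : Function.Injective lY)
    (hμX0 : ∀ x, 0 ≤ μX x) (hμX1 : ∑ x, μX x = 1)
    (hmX0 : ∀ x x', 0 ≤ mX x x') (hmX1 : ∀ x, ∑ x', mX x x' = 1)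
    (hsX : ∀ x', ∑ x, μX x * mX x x' = μX x')
    (hμY0 : ∀ y, 0 ≤ μY y) (hμY1 : ∑ y, μY y = 1)
    (hmY0 : ∀ y y', 0 ≤ mY y y') (hmY1 : ∀ y, ∑ y', mY y y' = 1)
    (hsY : ∀ y', ∑ y, μY y * mY y y' = μY y') :
    (fun π : Measure ((Fin (k + 1) → X) × (Fin (k + 1) → Y)) =>
        π.map (fun p => (fun i => lX (p.1 i), fun i => lY (p.2 i)))) ''
      {π | IsBicausalCoupling k (pathMeas μX mX k) (pathMeas μY mY k) π} =
    {π | IsBicausalCoupling k ((pathMeas μX mX k).map (fun xs => fun i => lX (xs i)))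
          ((pathMeas μY mY k).map (fun ys => fun i => lY (ys i))) π} := by
  ext ρ
  constructor
  · rintro ⟨π, hπ, rfl⟩
    exact (isBicausalCoupling_map_iff hlX hlY _ _ _).2 hπ
  · intro hρ
    obtain ⟨π, rfl⟩ := exists_map_prodMap_eq
      (measurableEmbedding_of_finite hlX.comp_left) (measurableEmbedding_of_finite hlY.comp_left)
      hρ.1 hρ.2.1
    exact ⟨π, (isBicausalCoupling_map_iff hlX hlY _ _ _).1 hρ, rfl⟩
end

section
/- Fix q ∈ (0,1), d ≥ 1 and k ∈ ℕ, and let (G₁,ℓ_{G₁}) and (G₂,ℓ_{G₂}) be ℝ^d-labeled finite edge-weighted graphs. (1) If d_{G,q}^(k)((G₁,ℓ_{G₁}),(G₂,ℓ_{G₂})) = 0, then every k-layer MP-GNN h (with damping q and Lipschitz maps φ_1,…,φ_{k+1}, ψ) satisfies h((G₁,ℓ_{G₁})) = h((G₂,ℓ_{G₂})). (2) If d_{G,q}^(k)((G₁,ℓ_{G₁}),(G₂,ℓ_{G₂})) > 0, then there exists a k-layer MP-GNN h (with damping q and Lipschitz maps φ_1,…,φ_{k+1}, ψ) such that h((G₁,ℓ_{G₁}))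 ≠ h((G₂,ℓ_{G₂})). -/
open Finset

noncomputable section

/-- An ℝ^d-labeled finite edge-weighted graph: nonempty vertex set `Fin n`, symmetric
nonnegative weights with zero diagonal (an edge is present exactly when its weight is
positive), and vertex labels in `ℝ^d`. -/
structure LabeledGraph (d : ℕ) where
  n : ℕ
  n_pos : 0 < n
  w : Fin n → Fin n → ℝ
  w_nonneg : ∀ u v, 0 ≤ w u v
  w_symm : ∀ u v, w u v = w v u
  w_loopless : ∀ v, w v v = 0
  label : Fin n → EuclideanSpace ℝ (Fin d)

namespace LabeledGraph

variable {d : ℕ}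

/-- The (weighted) degree `deg(v) = Σ_{v'} w_{vv'}`. -/
def deg (G : LabeledGraph d) (v : Fin G.n) : ℝ := ∑ v', G.w v v'

/-- The modified degree `d̄eg(v)`. -/
def dbar (G : LabeledGraph d) (v : Fin G.n) : ℝ := if 0 < G.deg v then G.deg v else 1

/-- The stationary measure `μ_G(v) = d̄eg(v)/Σ_{v'} d̄eg(v')`. -/
def statMeas (G : LabeledGraph d) (v : Fin G.n) : ℝ := G.dbar v / ∑ v', G.dbar v'

/-- The `q`-damped Markov kernel `m^{G,q}` of the graph, by its value at `v'`. -/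
def kernel (G : LabeledGraph d) (q : ℝ) (v v' : Fin G.n) : ℝ :=
  if 0 < G.deg v then (if v' = v then q else 0) + (1 - q) * G.w v v' / G.deg v
  else if v' = v then 1 else 0

end LabeledGraph

/-- The `q`-damped WL distance of depth `k` between labeled graphs. -/
def dGq {d : ℕ} (q : ℝ) (k : ℕ) (G₁ G₂ : LabeledGraph d) : ℝ :=
  dWL k (G₁.kernel q) G₁.statMeas G₁.label (G₂.kernel q) G₂.statMeas G₂.label

/-- Dimension sequence with prescribed initial value `d` and tail `t`. -/
def dimSeq (d : ℕ) (t : ℕ → ℕ) : ℕ → ℕ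
  | 0 => d
  | i + 1 => t i

/-- The node features `ℓ_G^i` computed by the message-passing layers of an MP-GNN with
damping `q` and maps `φ` (here `φ i` is the paper's `φ_{i+1}`). -/
def gnnLabel (q : ℝ) (dims : ℕ → ℕ)
    (φ : (i : ℕ) → EuclideanSpace ℝ (Fin (dims i)) → EuclideanSpace ℝ (Fin (dims (i + 1))))
    (G : LabeledGraph (dims 0)) : (i : ℕ) → Fin G.n → EuclideanSpace ℝ (Fin (dims i))
  | 0, v => G.label v
  | i + 1, v =>
    if 0 < G.deg v then
      q • φ i (gnnLabel q dims φ G i v) +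
        ((1 - q) / G.deg v) • ∑ v', G.w v v' • φ i (gnnLabel q dims φ G i v')
    else φ i (gnnLabel q dims φ G i v)

/-- The output of a `k`-layer MP-GNN with damping `q`:
`h(G) = ψ( Σ_v (d̄eg(v)/Σ d̄eg) φ_{k+1}(ℓ_G^k(v)) )`. -/
def gnnOut (q : ℝ) (dims : ℕ → ℕ) (k : ℕ)
    (φ : (i : ℕ) → EuclideanSpace ℝ (Fin (dims i)) → EuclideanSpace ℝ (Fin (dims (i + 1))))
    (ψ : EuclideanSpace ℝ (Fin (dims (k + 1))) → ℝ)
    (G : LabeledGraph (dims 0)) : ℝ :=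
  ψ (∑ v, G.statMeas v • φ k (gnnLabel q dims φ G k v))

end

namespace LabeledGraph

variable {d : ℕ}

theorem dbar_pos (G : LabeledGraph d) (v : Fin G.n) : 0 < G.dbar v := by
  unfold dbar
  split_ifs with h
  · exact h
  · exact one_pos

theorem sum_dbar_pos (G : LabeledGraph d) : 0 < ∑ v, G.dbar v :=
  Finset.sum_pos (fun v _ => G.dbar_pos v) ⟨⟨0, G.n_pos⟩, Finset.mem_univ _⟩

theorem statMeas_nonneg (G : LabeledGraph d) (v : Fin G.n) : 0 ≤ G.statMeas v :=
  div_nonneg (G.dbar_pos v).le G.sum_dbar_pos.le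

theorem sum_statMeas (G : LabeledGraph d) : ∑ v, G.statMeas v = 1 := by
  simp only [statMeas, ← Finset.sum_div]
  exact div_self G.sum_dbar_pos.ne'

theorem kernel_nonneg (G : LabeledGraph d) {q : ℝ} (hq0 : 0 ≤ q) (hq1 : q ≤ 1)
    (v v' : Fin G.n) : 0 ≤ G.kernel q v v' := by
  unfold kernel
  split_ifs with h h'
  · exact add_nonneg hq0 (div_nonneg (mul_nonneg (sub_nonneg.2 hq1) (G.w_nonneg _ _)) h.le)
  · rw [zero_add]
    exact div_nonneg (mul_nonneg (sub_nonneg.2 hq1) (G.w_nonneg _ _)) h.le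
  · exact zero_le_one
  · exact le_rfl

theorem sum_kernel_smul (G : LabeledGraph d) {E : Type*} [AddCommGroup E] [Module ℝ E] (q : ℝ)
    (f : Fin G.n → E) (v : Fin G.n) :
    ∑ v', G.kernel q v v' • f v' =
      if 0 < G.deg v then q • f v + ((1 - q) / G.deg v) • ∑ v', G.w v v' • f v' else f v := by
  unfold kernel
  split_ifs with h
  · simp only [add_smul, Finset.sum_add_distrib, ite_smul, zero_smul, Finset.sum_ite_eq',
      Finset.mem_univ, if_true, Finset.smul_sum, smul_smul]
    congr 1
    refine Finset.sum_congr rfl fun v' _ => ?_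
    congr 1
    ring
  · simp

theorem sum_kernel (G : LabeledGraph d) (q : ℝ) (v : Fin G.n) :
    ∑ v', G.kernel q v v' = 1 := by
  have h := G.sum_kernel_smul q (fun _ => (1 : ℝ)) v
  simp only [smul_eq_mul, mul_one] at h
  rw [h]
  split_ifs with hv
  · rw [show ∑ v', G.w v v' = G.deg v from rfl]
    field_simp
    ring
  · rfl

end LabeledGraph

theorem gnnLabel_succ (q : ℝ) (dims : ℕ → ℕ)
    (φ : (i : ℕ) → EuclideanSpace ℝ (Fin (dims i)) → EuclideanSpace ℝ (Fin (dims (i + 1))))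
    (G : LabeledGraph (dims 0)) (i : ℕ) (v : Fin G.n) :
    gnnLabel q dims φ G (i + 1) v =
      ∑ v', G.kernel q v v' • φ i (gnnLabel q dims φ G i v') := by
  rw [G.sum_kernel_smul, gnnLabel]

section Couplings

variable {A B : Type*} [Fintype A] [Fintype B]

/-- Two nonnegative vectors whose pushforwards under `f` and `g` agree admit a coupling supported
on `{(a, b) | f a = g b}`. -/
theorem exists_isCouplingFn_of_fiber {Z : Type*} [DecidableEq Z] {p : A → ℝ} {p' : B → ℝ}
    (hp : ∀ a, 0 ≤ p a) (hp' : ∀ b, 0 ≤ p' b) (f : A → Z) (g : B → Z)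
    (h : ∀ z, (∑ a, if f a = z then p a else 0) = ∑ b, if g b = z then p' b else 0) :
    ∃ π, IsCouplingFn π p p' ∧ ∀ r, π r ≠ 0 → f r.1 = g r.2 := by
  have hP : ∀ z, 0 ≤ ∑ a, if f a = z then p a else 0 := fun z =>
    Finset.sum_nonneg fun a _ => by split_ifs <;> simp [hp]
  set P : Z → ℝ := fun z => ∑ a, if f a = z then p a else 0 with hPdef
  have hle : ∀ a, p a ≤ P (f a) := fun a => by
    have := Finset.single_le_sum (f := fun a' => if f a' = f a then p a' else 0)
      (fun a' _ => by split_ifs <;> simp [hp]) (Finset.mem_univ a)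
    simpa using this
  have hle' : ∀ b, p' b ≤ P (g b) := fun b => by
    have := Finset.single_le_sum (f := fun b' => if g b' = g b then p' b' else 0)
      (fun b' _ => by split_ifs <;> simp [hp']) (Finset.mem_univ b)
    rw [hPdef]
    simp only [h]
    simpa using this
  have key : ∀ {x y : ℝ}, 0 ≤ x → x ≤ y → x / y * y = x := fun {x y} h0 h1 => by
    rcases eq_or_ne y 0 with rfl | hy
    · simp [le_antisymm h1 h0]
    · field_simp
  refine ⟨fun r => if f r.1 = g r.2 then p r.1 * p' r.2 / P (f r.1) else 0, ⟨?_, ?_, ?_⟩, ?_⟩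
  · intro r
    dsimp only
    split_ifs
    · exact div_nonneg (mul_nonneg (hp _) (hp' _)) (hP _)
    · exact le_rfl
  · intro a
    calc _ = p a / P (f a) * ∑ b, (if g b = f a then p' b else 0) := by
          rw [Finset.mul_sum]
          refine Finset.sum_congr rfl fun b _ => ?_
          by_cases hab : f a = g b
          · simp only [hab, if_true]; ring
          · simp [hab, Ne.symm hab]
      _ = p a := by rw [← h]; exact key (hp a) (hle a)
  · intro b
    calc _ = p' b / P (g b) * ∑ a, (if f a = g b then p a else 0) := by
          rw [Finset.mul_sum]
          refine Finset.sum_congr rfl fun a _ => ?_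
          by_cases hab : f a = g b
          · simp only [hab, if_true]; ring
          · simp [hab]
      _ = p' b := key (hp' b) (hle' b)
  · intro r hr
    by_contra hne
    simp [hne] at hr

theorem exists_isCouplingFn {p : A → ℝ} {p' : B → ℝ}
    (hp : ∀ a, 0 ≤ p a) (hp' : ∀ b, 0 ≤ p' b) (h : ∑ a, p a = ∑ b, p' b) :
    ∃ π, IsCouplingFn π p p' := by
  obtain ⟨π, hπ, -⟩ := exists_isCouplingFn_of_fiber hp hp' (fun _ => ()) (fun _ => ())
    (fun z => by simpa using h)
  exact ⟨π, hπ⟩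

theorem IsCouplingFn.sum_smul_fst {E : Type*} [AddCommGroup E] [Module ℝ E] {π : A × B → ℝ}
    {p : A → ℝ} {p' : B → ℝ} (h : IsCouplingFn π p p') (f : A → E) :
    ∑ a, p a • f a = ∑ r, π r • f r.1 := by
  simp only [Fintype.sum_prod_type, ← h.2.1, Finset.sum_smul]

theorem IsCouplingFn.sum_smul_snd {E : Type*} [AddCommGroup E] [Module ℝ E] {π : A × B → ℝ}
    {p : A → ℝ} {p' : B → ℝ} (h : IsCouplingFn π p p') (f : B → E) :
    ∑ b, p' b • f b = ∑ r, π r • f r.2 := by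
  simp only [Fintype.sum_prod_type_right, ← h.2.2, Finset.sum_smul]

/-- Averages of Lipschitz images of two families are at most as far apart as the expected distance
under any coupling of the averaging weights. -/
theorem IsCouplingFn.dist_sum_smul_le {X E : Type*} [PseudoMetricSpace X]
    [SeminormedAddCommGroup E] [NormedSpace ℝ E] {π : A × B → ℝ} {p : A → ℝ} {p' : B → ℝ}
    (h : IsCouplingFn π p p') {c : NNReal} {φ : X → E} (hφ : LipschitzWith c φ)
    (f : A → X) (g : B → X) :
    dist (∑ a, p a • φ (f a)) (∑ b, p' b • φ (g b)) ≤
      c * ∑ r, π r * dist (f r.1) (g r.2) := by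
  rw [h.sum_smul_fst, h.sum_smul_snd, dist_eq_norm, ← Finset.sum_sub_distrib, Finset.mul_sum]
  refine norm_sum_le_of_le _ fun r _ => ?_
  rw [← smul_sub, norm_smul, Real.norm_of_nonneg (h.1 r), ← dist_eq_norm]
  calc π r * dist (φ (f r.1)) (φ (g r.2)) ≤ π r * (c * dist (f r.1) (g r.2)) :=
        mul_le_mul_of_nonneg_left (hφ.dist_le_mul _ _) (h.1 r)
    _ = c * (π r * dist (f r.1) (g r.2)) := by ring

theorem sum_odotFn_mul (ν : A × B → A × B → ℝ) (γ c : A × B → ℝ) :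
    ∑ r, odotFn ν γ r * c r = ∑ p, γ p * ∑ r, ν p r * c r := by
  simp only [odotFn, Finset.sum_mul, Finset.mul_sum]
  rw [Finset.sum_comm]
  simp only [mul_assoc]

variable [DecidableEq A] [DecidableEq B] {mA : A → A → ℝ} {mB : B → B → ℝ}

/-- A `(k + 1)`-step coupling is a 1-step coupling followed by a `k`-step coupling. -/
theorem IsKStepCoupling.exists_of_succ {k : ℕ} {ν : A × B → A × B → ℝ}
    (h : IsKStepCoupling mA mB (k + 1) ν) :
    ∃ ν' ν₁, IsKStepCoupling mA mB k ν' ∧ IsOneStepCoupling mA mB ν₁ ∧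
      ∀ p r, ν p r = ∑ s, ν₁ p s * ν' s r := by
  cases h with
  | one _ h => exact ⟨_, ν, .zero (fun p r => if r = p then 1 else 0) fun _ _ => rfl, h, by simp⟩
  | succ _ ν' ν₁ _ h' h₁ h => exact ⟨ν', ν₁, h', h₁, h⟩

theorem IsKStepCoupling.nonneg {k : ℕ} {ν : A × B → A × B → ℝ}
    (h : IsKStepCoupling mA mB k ν) (p r : A × B) : 0 ≤ ν p r := by
  induction h generalizing p r with
  | zero ν h => rw [h]; split_ifs <;> simp
  | one ν h => exact (h p).1 r
  | succ k ν' ν₁ ν h' h₁ h ih =>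
    rw [h]
    exact Finset.sum_nonneg fun s _ => mul_nonneg ((h₁ p).1 s) (ih s r)

theorem exists_isKStepCoupling (hA : ∀ a a', 0 ≤ mA a a') (hB : ∀ b b', 0 ≤ mB b b')
    (hAB : ∀ a b, ∑ a', mA a a' = ∑ b', mB b b') (k : ℕ) :
    ∃ ν, IsKStepCoupling mA mB k ν := by
  induction k with
  | zero => exact ⟨_, .zero (fun p r => if r = p then 1 else 0) fun _ _ => rfl⟩
  | succ k ih =>
    obtain ⟨ν', h'⟩ := ih
    choose ν₁ h₁ using fun p : A × B => exists_isCouplingFn (hA p.1) (hB p.2) (hAB p.1 p.2)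
    exact ⟨_, .succ k ν' ν₁ _ h' h₁ fun _ _ => rfl⟩

theorem dWL_le {Z : Type*} [PseudoMetricSpace Z] {k : ℕ} {μA : A → ℝ} {μB : B → ℝ}
    (lA : A → Z) (lB : B → Z) {γ : A × B → ℝ} {ν : A × B → A × B → ℝ}
    (hγ : IsCouplingFn γ μA μB) (hν : IsKStepCoupling mA mB k ν) :
    dWL k mA μA lA mB μB lB ≤ ∑ p, odotFn ν γ p * dist (lA p.1) (lB p.2) := by
  refine csInf_le ⟨0, ?_⟩ ⟨γ, ν, hγ, hν, rfl⟩
  rintro _ ⟨γ, ν, hγ, hν, rfl⟩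
  exact Finset.sum_nonneg fun p _ => mul_nonneg
    (Finset.sum_nonneg fun s _ => mul_nonneg (hγ.1 s) (hν.nonneg s p)) dist_nonneg

end Couplings

section Upper

variable {q : ℝ} {dims : ℕ → ℕ}
  {φ : (i : ℕ) → EuclideanSpace ℝ (Fin (dims i)) → EuclideanSpace ℝ (Fin (dims (i + 1)))}

theorem dist_gnnLabel_le {c : ℕ → NNReal} (hφ : ∀ i, LipschitzWith (c i) (φ i))
    (G₁ G₂ : LabeledGraph (dims 0)) (k : ℕ)
    {ν : Fin G₁.n × Fin G₂.n → Fin G₁.n × Fin G₂.n → ℝ}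
    (hν : IsKStepCoupling (G₁.kernel q) (G₂.kernel q) k ν) (p : Fin G₁.n × Fin G₂.n) :
    dist (gnnLabel q dims φ G₁ k p.1) (gnnLabel q dims φ G₂ k p.2) ≤
      (∏ i ∈ Finset.range k, (c i : ℝ)) *
        ∑ r, ν p r * dist (G₁.label r.1) (G₂.label r.2) := by
  induction k generalizing ν p with
  | zero =>
    cases hν with
    | zero _ h => simp [h, gnnLabel]
  | succ k ih =>
    obtain ⟨ν', ν₁, h', h₁, h⟩ := hν.exists_of_succ
    simp only [gnnLabel_succ]
    refine ((h₁ p).dist_sum_smul_le (hφ k) _ _).trans ?_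
    calc _ ≤ c k * ∑ s, ν₁ p s * ((∏ i ∈ Finset.range k, (c i : ℝ)) *
            ∑ r, ν' s r * dist (G₁.label r.1) (G₂.label r.2)) := by
          gcongr with s
          · exact (h₁ p).1 s
          · exact ih h' s
      _ = _ := by
          simp only [h, Finset.prod_range_succ, Finset.sum_mul, Finset.mul_sum]
          rw [Finset.sum_comm]
          refine Finset.sum_congr rfl fun r _ => Finset.sum_congr rfl fun s _ => ?_
          ring

theorem dist_gnnOut_le {k : ℕ} {ψ : EuclideanSpace ℝ (Fin (dims (k + 1))) → ℝ}
    {c : ℕ → NNReal} {c' : NNReal} (hφ : ∀ i, LipschitzWith (c i) (φ i))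
    (hψ : LipschitzWith c' ψ) (hq0 : 0 ≤ q) (hq1 : q ≤ 1) (G₁ G₂ : LabeledGraph (dims 0)) :
    dist (gnnOut q dims k φ ψ G₁) (gnnOut q dims k φ ψ G₂) ≤
      c' * (∏ i ∈ Finset.range (k + 1), (c i : ℝ)) * dGq q k G₁ G₂ := by
  unfold dGq dWL
  rw [← smul_eq_mul, ← Real.sInf_smul_of_nonneg (by positivity)]
  refine le_csInf (Set.Nonempty.smul_set ?_) ?_
  · obtain ⟨γ, hγ⟩ := exists_isCouplingFn G₁.statMeas_nonneg G₂.statMeas_nonneg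
      (by rw [G₁.sum_statMeas, G₂.sum_statMeas])
    obtain ⟨ν, hν⟩ := exists_isKStepCoupling (G₁.kernel_nonneg hq0 hq1) (G₂.kernel_nonneg hq0 hq1)
      (fun a b => by rw [G₁.sum_kernel, G₂.sum_kernel]) k
    exact ⟨_, γ, ν, hγ, hν, rfl⟩
  · rintro _ ⟨_, ⟨γ, ν, hγ, hν, rfl⟩, rfl⟩
    simp only [sum_odotFn_mul, smul_eq_mul]
    refine (hψ.dist_le_mul _ _).trans ?_
    rw [mul_assoc]
    refine mul_le_mul_of_nonneg_left ((hγ.dist_sum_smul_le (hφ k) _ _).trans ?_) c'.2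
    rw [Finset.prod_range_succ, mul_comm _ (c k : ℝ), mul_assoc]
    refine mul_le_mul_of_nonneg_left ?_ (c k).2
    rw [Finset.mul_sum]
    refine Finset.sum_le_sum fun p _ => ?_
    rw [mul_left_comm]
    exact mul_le_mul_of_nonneg_left (dist_gnnLabel_le hφ G₁ G₂ k hν p) (hγ.1 p)

end Upper

section Separation

theorem exists_lipschitz_eq_one_eq_zero {X : Type*} [MetricSpace X] {S : Set X} (hS : S.Finite)
    (z : X) : ∃ f : X → ℝ, (∃ c, LipschitzWith c f) ∧ f z = 1 ∧ ∀ x ∈ S, x ≠ z → f x = 0 := by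
  rcases (S \ {z}).eq_empty_or_nonempty with h | h
  · refine ⟨fun _ => 1, ⟨0, LipschitzWith.const 1⟩, rfl, fun x hx hxz => ?_⟩
    exact absurd (show x ∈ S \ {z} from ⟨hx, hxz⟩) (by simp [h])
  · have hz : Metric.infDist z (S \ {z}) ≠ 0 := fun h0 => by
      have := (hS.subset Set.sdiff_subset).isClosed.mem_iff_infDist_zero h |>.2 h0
      exact this.2 rfl
    refine ⟨fun x => (Metric.infDist z (S \ {z}))⁻¹ • Metric.infDist x (S \ {z}),
      ⟨_, (lipschitzWith_smul _).comp (Metric.lipschitz_infDist_pt _)⟩, ?_, fun x hx hxz => ?_⟩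
    · simp [hz]
    · simp [Metric.infDist_zero_of_mem (show x ∈ S \ {z} from ⟨hx, hxz⟩)]

variable {X : Type*} [MetricSpace X]

/-- `φ` is Lipschitz, and any two weighted averages of `φ` along the families `f` and `g`
determine the pushforwards of the weights under `f` and `g`. -/
def IsSeparating {a b M : ℕ} (f : Fin a → X) (g : Fin b → X)
    (φ : X → EuclideanSpace ℝ (Fin M)) : Prop :=
  (∃ c, LipschitzWith c φ) ∧ ∀ (p : Fin a → ℝ) (p' : Fin b → ℝ),
    ∑ i, p i • φ (f i) = ∑ j, p' j • φ (g j) →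
      ∀ z, (∑ i, Set.indicator {i | f i = z} p i) = ∑ j, Set.indicator {j | g j = z} p' j

theorem exists_isSeparating {a b : ℕ} (f : Fin a → X) (g : Fin b → X) :
    ∃ φ : X → EuclideanSpace ℝ (Fin (a + b)), IsSeparating f g φ := by
  classical
  have hS : (Set.range f ∪ Set.range g).Finite := (Set.finite_range f).union (Set.finite_range g)
  choose F c hF h1 h0 using fun i =>
    (exists_lipschitz_eq_one_eq_zero hS (Fin.append f g i)).imp fun F h =>
      (⟨h.1.choose, h.1.choose_spec, h.2.1, h.2.2⟩ : ∃ c, LipschitzWith c F ∧ _ ∧ _)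
  have hF' : LipschitzWith (∑ i, c i) fun x i => F i x := fun x y =>
    edist_pi_le_iff.2 fun i => (hF i x y).trans <| by
      gcongr
      exact Finset.single_le_sum (f := c) (fun _ _ => zero_le) (Finset.mem_univ i)
  refine ⟨fun x => WithLp.toLp 2 fun i => F i x,
    ⟨_, (PiLp.lipschitzWith_toLp 2 _).comp hF'⟩, ?_⟩
  intro p p' h
  have key : ∀ k, (∑ i, Set.indicator {i | f i = Fin.append f g k} p i) =
      ∑ j, Set.indicator {j | g j = Fin.append f g k} p' j := fun k => by
    have hf : ∀ i, Set.indicator {i | f i = Fin.append f g k} p i = p i * F k (f i) := fun i => by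
      by_cases hi : f i = Fin.append f g k
      · simp [hi, h1]
      · simp [hi, h0 k (f i) (Or.inl ⟨i, rfl⟩) hi]
    have hg : ∀ j, Set.indicator {j | g j = Fin.append f g k} p' j = p' j * F k (g j) :=
      fun j => by
        by_cases hj : g j = Fin.append f g k
        · simp [hj, h1]
        · simp [hj, h0 k (g j) (Or.inr ⟨j, rfl⟩) hj]
    simp only [hf, hg]
    simpa using congrArg (fun v : EuclideanSpace ℝ (Fin (a + b)) => v k) h
  intro z
  by_cases hz : ∃ k, Fin.append f g k = z
  · obtain ⟨k, rfl⟩ := hz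
    exact key k
  · have hf : ∀ i, f i ≠ z := fun i hi => hz ⟨Fin.castAdd b i, by simpa using hi⟩
    have hg : ∀ j, g j ≠ z := fun j hj => hz ⟨Fin.natAdd a j, by simpa using hj⟩
    simp [hf, hg]

theorem IsSeparating.exists_coupling {a b M : ℕ} {f : Fin a → X} {g : Fin b → X}
    {φ : X → EuclideanSpace ℝ (Fin M)} (h : IsSeparating f g φ) {p : Fin a → ℝ} {p' : Fin b → ℝ}
    (hp : ∀ i, 0 ≤ p i) (hp' : ∀ j, 0 ≤ p' j)
    (he : ∑ i, p i • φ (f i) = ∑ j, p' j • φ (g j)) :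
    ∃ π, IsCouplingFn π p p' ∧ ∀ r, π r ≠ 0 → f r.1 = g r.2 := by
  classical
  exact exists_isCouplingFn_of_fiber hp hp' f g fun z => by
    simpa [Set.indicator_apply] using h.2 p p' he z

end Separation

section Lower

/-- Joint layerwise features of `G₁` and `G₂` when each layer map is `sep` of the preceding
features. -/
noncomputable def jointLabel (q : ℝ) (dims : ℕ → ℕ) (G₁ G₂ : LabeledGraph (dims 0))
    (sep : (i : ℕ) → (Fin G₁.n → EuclideanSpace ℝ (Fin (dims i))) →
      (Fin G₂.n → EuclideanSpace ℝ (Fin (dims i))) →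
      EuclideanSpace ℝ (Fin (dims i)) → EuclideanSpace ℝ (Fin (dims (i + 1)))) :
    (i : ℕ) → (Fin G₁.n → EuclideanSpace ℝ (Fin (dims i))) ×
      (Fin G₂.n → EuclideanSpace ℝ (Fin (dims i)))
  | 0 => (G₁.label, G₂.label)
  | i + 1 =>
    let L := jointLabel q dims G₁ G₂ sep i
    (fun v => ∑ v', G₁.kernel q v v' • sep i L.1 L.2 (L.1 v'),
      fun v => ∑ v', G₂.kernel q v v' • sep i L.1 L.2 (L.2 v'))

/-- There are layer maps each of which separates the features produced by the earlier ones. -/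
theorem exists_isSeparating_gnnLabel (q : ℝ) (dims : ℕ → ℕ) (G₁ G₂ : LabeledGraph (dims 0))
    (hdims : ∀ i, dims (i + 1) = G₁.n + G₂.n) :
    ∃ φ : (i : ℕ) → EuclideanSpace ℝ (Fin (dims i)) → EuclideanSpace ℝ (Fin (dims (i + 1))),
      ∀ i, IsSeparating (gnnLabel q dims φ G₁ i) (gnnLabel q dims φ G₂ i) (φ i) := by
  have hsep : ∀ i (f : Fin G₁.n → EuclideanSpace ℝ (Fin (dims i)))
      (g : Fin G₂.n → EuclideanSpace ℝ (Fin (dims i))),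
      ∃ φ : EuclideanSpace ℝ (Fin (dims i)) → EuclideanSpace ℝ (Fin (dims (i + 1))),
        IsSeparating f g φ := fun i f g => by
    rw [hdims i]
    exact exists_isSeparating f g
  choose sep hsep using hsep
  set L := jointLabel q dims G₁ G₂ sep
  have hL : ∀ i, gnnLabel q dims (fun i => sep i (L i).1 (L i).2) G₁ i = (L i).1 ∧
      gnnLabel q dims (fun i => sep i (L i).1 (L i).2) G₂ i = (L i).2 := fun i => by
    induction i with
    | zero => exact ⟨rfl, rfl⟩
    | succ i ih =>
      constructor
      · funext v
        rw [gnnLabel_succ, ih.1]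
        rfl
      · funext v
        rw [gnnLabel_succ, ih.2]
        rfl
  refine ⟨fun i => sep i (L i).1 (L i).2, fun i => ?_⟩
  rw [(hL i).1, (hL i).2]
  exact hsep i _ _

variable {q : ℝ} {dims : ℕ → ℕ}
  {φ : (i : ℕ) → EuclideanSpace ℝ (Fin (dims i)) → EuclideanSpace ℝ (Fin (dims (i + 1)))}

theorem exists_isKStepCoupling_of_isSeparating (hq0 : 0 ≤ q) (hq1 : q ≤ 1)
    (G₁ G₂ : LabeledGraph (dims 0))
    (hφ : ∀ i, IsSeparating (gnnLabel q dims φ G₁ i) (gnnLabel q dims φ G₂ i) (φ i)) (k : ℕ) :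
    ∃ ν, IsKStepCoupling (G₁.kernel q) (G₂.kernel q) k ν ∧
      ∀ p : Fin G₁.n × Fin G₂.n, gnnLabel q dims φ G₁ k p.1 = gnnLabel q dims φ G₂ k p.2 →
        ∀ r, ν p r ≠ 0 → G₁.label r.1 = G₂.label r.2 := by
  induction k with
  | zero =>
    refine ⟨_, .zero (fun p r => if r = p then 1 else 0) fun _ _ => rfl, fun p hp r hr => ?_⟩
    have : r = p := by
      by_contra hne
      simp [hne] at hr
    exact this ▸ hp
  | succ k ih =>
    obtain ⟨ν', h', hν'⟩ := ih
    have hstep : ∀ p : Fin G₁.n × Fin G₂.n, ∃ π,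
        IsCouplingFn π (G₁.kernel q p.1) (G₂.kernel q p.2) ∧
          (gnnLabel q dims φ G₁ (k + 1) p.1 = gnnLabel q dims φ G₂ (k + 1) p.2 →
            ∀ s, π s ≠ 0 → gnnLabel q dims φ G₁ k s.1 = gnnLabel q dims φ G₂ k s.2) := fun p => by
      have h₁ := G₁.kernel_nonneg hq0 hq1 p.1
      have h₂ := G₂.kernel_nonneg hq0 hq1 p.2
      by_cases hp : gnnLabel q dims φ G₁ (k + 1) p.1 = gnnLabel q dims φ G₂ (k + 1) p.2
      · simp only [gnnLabel_succ] at hp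
        obtain ⟨π, hπ, hs⟩ := (hφ k).exists_coupling h₁ h₂ hp
        exact ⟨π, hπ, fun _ => hs⟩
      · obtain ⟨π, hπ⟩ := exists_isCouplingFn h₁ h₂ (by rw [G₁.sum_kernel, G₂.sum_kernel])
        exact ⟨π, hπ, fun h => absurd h hp⟩
    choose ν₁ h₁ hν₁ using hstep
    refine ⟨_, .succ k ν' ν₁ _ h' h₁ fun _ _ => rfl, fun p hp r hr => ?_⟩
    obtain ⟨s, -, hs⟩ := Finset.exists_ne_zero_of_sum_ne_zero hr
    exact hν' s (hν₁ p hp s (left_ne_zero_of_mul hs)) r (right_ne_zero_of_mul hs)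

theorem dGq_le_zero_of_isSeparating (hq0 : 0 ≤ q) (hq1 : q ≤ 1)
    (G₁ G₂ : LabeledGraph (dims 0))
    (hφ : ∀ i, IsSeparating (gnnLabel q dims φ G₁ i) (gnnLabel q dims φ G₂ i) (φ i)) (k : ℕ)
    (h : ∑ v, G₁.statMeas v • φ k (gnnLabel q dims φ G₁ k v) =
      ∑ v, G₂.statMeas v • φ k (gnnLabel q dims φ G₂ k v)) :
    dGq q k G₁ G₂ ≤ 0 := by
  obtain ⟨ν, hν, hν'⟩ := exists_isKStepCoupling_of_isSeparating hq0 hq1 G₁ G₂ hφ k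
  obtain ⟨γ, hγ, hγ'⟩ := (hφ k).exists_coupling G₁.statMeas_nonneg G₂.statMeas_nonneg h
  refine (dWL_le G₁.label G₂.label hγ hν).trans_eq ?_
  rw [sum_odotFn_mul]
  refine Finset.sum_eq_zero fun p _ => ?_
  by_cases hp : γ p = 0
  · rw [hp, zero_mul]
  rw [Finset.sum_eq_zero fun r _ => ?_, mul_zero]
  by_cases hr : ν p r = 0
  · rw [hr, zero_mul]
  · rw [hν' p (hγ' p hp) r hr, dist_self, mul_zero]

end Lower

/-!
STATEMENT 10: Fix `q ∈ (0,1)`, `d ≥ 1` and `k ∈ ℕ`, and let `(G₁,ℓ_{G₁})` and `(G₂,ℓ_{G₂})`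
be ℝ^d-labeled finite edge-weighted graphs.
(1) If `d_{G,q}^{(k)}(G₁,G₂) = 0`, then every `k`-layer MP-GNN `h` (with damping `q` and
Lipschitz maps `φ_1,…,φ_{k+1}, ψ`) satisfies `h(G₁) = h(G₂)`.
(2) If `d_{G,q}^{(k)}(G₁,G₂) > 0`, then there exists such a `k`-layer MP-GNN `h` with
`h(G₁) ≠ h(G₂)`.
-/
theorem mpgnn_discriminative_power (q : ℝ) (hq0 : 0 < q) (hq1 : q < 1)
    (d : ℕ) (hd : 1 ≤ d) (k : ℕ) (G₁ G₂ : LabeledGraph d) :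
    (dGq q k G₁ G₂ = 0 →
      ∀ (t : ℕ → ℕ)
        (φ : (i : ℕ) → EuclideanSpace ℝ (Fin (dimSeq d t i)) →
          EuclideanSpace ℝ (Fin (dimSeq d t (i + 1))))
        (ψ : EuclideanSpace ℝ (Fin (dimSeq d t (k + 1))) → ℝ),
        (∀ i, ∃ c : NNReal, LipschitzWith c (φ i)) → (∃ c : NNReal, LipschitzWith c ψ) →
        gnnOut q (dimSeq d t) k φ ψ G₁ = gnnOut q (dimSeq d t) k φ ψ G₂) ∧
    (0 < dGq q k G₁ G₂ →
      ∃ (t : ℕ → ℕ)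
        (φ : (i : ℕ) → EuclideanSpace ℝ (Fin (dimSeq d t i)) →
          EuclideanSpace ℝ (Fin (dimSeq d t (i + 1))))
        (ψ : EuclideanSpace ℝ (Fin (dimSeq d t (k + 1))) → ℝ),
        (∀ i, ∃ c : NNReal, LipschitzWith c (φ i)) ∧ (∃ c : NNReal, LipschitzWith c ψ) ∧
        gnnOut q (dimSeq d t) k φ ψ G₁ ≠ gnnOut q (dimSeq d t) k φ ψ G₂) := by
  constructor
  · intro h t φ ψ hφ hψ
    choose c hφ using hφ
    obtain ⟨c', hψ⟩ := hψ
    have hle := dist_gnnOut_le (dims := dimSeq d t) hφ hψ hq0.le hq1.le G₁ G₂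
    rw [show dGq (d := dimSeq d t 0) q k G₁ G₂ = 0 from h, mul_zero] at hle
    exact dist_le_zero.1 hle
  · intro h
    set t : ℕ → ℕ := fun _ => G₁.n + G₂.n
    obtain ⟨φ, hφ⟩ := exists_isSeparating_gnnLabel q (dimSeq d t) G₁ G₂ fun _ => rfl
    refine ⟨t, φ, fun x => dist x
      (∑ v, G₂.statMeas v • φ k (gnnLabel q (dimSeq d t) φ G₂ k v)),
      fun i => (hφ i).1, ⟨1, LipschitzWith.dist_left _⟩, fun he => h.not_ge ?_⟩
    refine dGq_le_zero_of_isSeparating (dims := dimSeq d t) hq0.le hq1.le G₁ G₂ hφ k ?_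
    exact dist_eq_zero.1 (he.trans (dist_self _))
end

section
/- Fix ε ≥ 0 and let h be a k-layer normalized GIN built from maps φ_1,…,φ_k and ψ, where φ_i is C_i-Lipschitz for each i = 1,…,k and ψ is C-Lipschitz. Then for any two ℝ^d-labeled weighted graphs (G₁,ℓ_{G₁}) and (G₂,ℓ_{G₂}): |h((G₁,ℓ_{G₁})) − h((G₂,ℓ_{G₂}))| ≤ C · (∏_{i=1}^{k} C_i) · d_{G,(ε)}^(k)((G₁,ℓ_{G₁}),(G₂,ℓ_{G₂})). -/
open Finset

noncomputable section

namespace LabeledGraph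

variable {d : ℕ}

/-- The modified degree `deg^ε(v) := deg(v) + 1 + ε`. -/
def degEps (G : LabeledGraph d) (ε : ℝ) (v : Fin G.n) : ℝ := G.deg v + 1 + ε

/-- The `ε`-normalized Markov kernel
`m^{G,(ε)}_v = (1/(deg(v)+1+ε)) ((1+ε) δ_v + Σ_{v'} w_{vv'} δ_{v'})`, by its value at `v'`. -/
def kernelEps (G : LabeledGraph d) (ε : ℝ) (v v' : Fin G.n) : ℝ :=
  ((if v' = v then 1 + ε else 0) + G.w v v') / (G.deg v + 1 + ε)

/-- The stationary measure `μ_G^ε(v) = deg^ε(v)/Σ_{v'} deg^ε(v')`. -/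
def statMeasEps (G : LabeledGraph d) (ε : ℝ) (v : Fin G.n) : ℝ :=
  G.degEps ε v / ∑ v', G.degEps ε v'

end LabeledGraph

/-- The `ε`-normalized WL distance of depth `k` between labeled graphs:
the WL distance between the induced LMMCs `(𝒳_{(ε)}(G_i), ℓ_{G_i})`. -/
def dGeps {d : ℕ} (ε : ℝ) (k : ℕ) (G₁ G₂ : LabeledGraph d) : ℝ :=
  dWL k (G₁.kernelEps ε) (G₁.statMeasEps ε) G₁.label
    (G₂.kernelEps ε) (G₂.statMeasEps ε) G₂.label

/-- The node features `ℓ_G^i` of a `k`-layer normalized GIN (here `φ i` is the paper's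
`φ_{i+1}`):
`ℓ_G^{i+1}(v) = φ_{i+1}( (1/(deg(v)+1+ε)) ((1+ε) ℓ_G^i(v) + Σ_{v'} w_{vv'} ℓ_G^i(v')) )`. -/
def ginLabel (ε : ℝ) (dims : ℕ → ℕ)
    (φ : (i : ℕ) → EuclideanSpace ℝ (Fin (dims i)) → EuclideanSpace ℝ (Fin (dims (i + 1))))
    (G : LabeledGraph (dims 0)) : (i : ℕ) → Fin G.n → EuclideanSpace ℝ (Fin (dims i))
  | 0, v => G.label v
  | i + 1, v =>
    φ i ((1 / (G.deg v + 1 + ε)) •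
      ((1 + ε) • ginLabel ε dims φ G i v + ∑ v', G.w v v' • ginLabel ε dims φ G i v'))

/-- The output of a `k`-layer normalized GIN:
`h(G) = ψ( Σ_v (deg^ε(v)/Σ deg^ε) ℓ_G^k(v) )`. -/
def ginOut (ε : ℝ) (dims : ℕ → ℕ) (k : ℕ)
    (φ : (i : ℕ) → EuclideanSpace ℝ (Fin (dims i)) → EuclideanSpace ℝ (Fin (dims (i + 1))))
    (ψ : EuclideanSpace ℝ (Fin (dims k)) → ℝ)
    (G : LabeledGraph (dims 0)) : ℝ :=
  ψ (∑ v, G.statMeasEps ε v • ginLabel ε dims φ G k v)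

end

namespace IsCouplingFn

variable {A B : Type*} [Fintype A] [Fintype B] {π : A × B → ℝ} {p : A → ℝ} {p' : B → ℝ}

/-- The product of two probability vectors is a coupling. -/
theorem prod (hp : ∀ a, 0 ≤ p a) (hp' : ∀ b, 0 ≤ p' b)
    (hp1 : ∑ a, p a = 1) (hp1' : ∑ b, p' b = 1) :
    IsCouplingFn (fun r : A × B => p r.1 * p' r.2) p p' :=
  ⟨fun r => mul_nonneg (hp r.1) (hp' r.2),
    fun a => by simp only [← Finset.mul_sum, hp1', mul_one],
    fun b => by simp only [← Finset.sum_mul, hp1, one_mul]⟩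

/-- The distance between two barycenters is at most the transport cost of any coupling. -/
theorem dist_sum_smul_le_s13 {E : Type*} [SeminormedAddCommGroup E] [NormedSpace ℝ E]
    (h : IsCouplingFn π p p') (f : A → E) (g : B → E) :
    dist (∑ a, p a • f a) (∑ b, p' b • g b) ≤ ∑ r, π r * dist (f r.1) (g r.2) := by
  have hf : ∑ a, p a • f a = ∑ r, π r • f r.1 := by
    simp only [Fintype.sum_prod_type, ← Finset.sum_smul, h.2.1]
  have hg : ∑ b, p' b • g b = ∑ r, π r • g r.2 := by
    simp only [Fintype.sum_prod_type_right, ← Finset.sum_smul, h.2.2]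
  rw [hf, hg]
  refine (dist_sum_sum_le _ _ _).trans_eq (Finset.sum_congr rfl fun r _ => ?_)
  rw [dist_smul₀, Real.norm_of_nonneg (h.1 r)]

end IsCouplingFn

section KStep

variable {A B : Type*} [Fintype A] [Fintype B] [DecidableEq A] [DecidableEq B]
  {mA : A → A → ℝ} {mB : B → B → ℝ}

/-- `k`-step couplings exist as soon as 1-step couplings do. -/
theorem IsOneStepCoupling.exists_isKStepCoupling {ν₁ : A × B → A × B → ℝ}
    (h : IsOneStepCoupling mA mB ν₁) (k : ℕ) : ∃ ν, IsKStepCoupling mA mB k ν := by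
  induction k with
  | zero => exact ⟨_, .zero _ fun _ _ => rfl⟩
  | succ k ih =>
    obtain ⟨ν', h'⟩ := ih
    exact ⟨_, .succ k ν' ν₁ _ h' h fun _ _ => rfl⟩

/-- To bound a number by a multiple of the WL distance, it suffices to bound it by the same
multiple of the cost of every coupling, provided that couplings exist. -/
theorem le_mul_dWL {Z : Type*} [PseudoMetricSpace Z] {k : ℕ}
    {μA : A → ℝ} {lA : A → Z} {μB : B → ℝ} {lB : B → Z} {a K : ℝ} (hK : 0 ≤ K)
    (hγ : ∃ γ, IsCouplingFn γ μA μB) (hν : ∃ ν, IsKStepCoupling mA mB k ν)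
    (h : ∀ γ ν, IsCouplingFn γ μA μB → IsKStepCoupling mA mB k ν →
      a ≤ K * ∑ p : A × B, odotFn ν γ p * dist (lA p.1) (lB p.2)) :
    a ≤ K * dWL k mA μA lA mB μB lB := by
  obtain ⟨γ, hγ⟩ := hγ
  obtain ⟨ν, hν⟩ := hν
  rcases hK.eq_or_lt with rfl | hK
  · simpa using h γ ν hγ hν
  · rw [← div_le_iff₀' hK]
    refine le_csInf ⟨_, γ, ν, hγ, hν, rfl⟩ ?_
    rintro r ⟨γ, ν, hγ, hν, rfl⟩
    rw [div_le_iff₀' hK]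
    exact h γ ν hγ hν

end KStep

namespace LabeledGraph

variable {d : ℕ} (G : LabeledGraph d) {ε : ℝ}

theorem degEps_pos (hε : 0 ≤ ε) (v : Fin G.n) : 0 < G.degEps ε v := by
  have : 0 ≤ G.deg v := Finset.sum_nonneg fun u _ => G.w_nonneg v u
  unfold degEps
  linarith

theorem kernelEps_nonneg (hε : 0 ≤ ε) (v v' : Fin G.n) : 0 ≤ G.kernelEps ε v v' := by
  refine div_nonneg (add_nonneg ?_ (G.w_nonneg v v')) (G.degEps_pos hε v).le
  split_ifs <;> linarith

theorem sum_kernelEps (hε : 0 ≤ ε) (v : Fin G.n) : ∑ v', G.kernelEps ε v v' = 1 := by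
  simp only [kernelEps, ← Finset.sum_div, Finset.sum_add_distrib, Finset.sum_ite_eq',
    Finset.mem_univ, if_true]
  refine (div_eq_one_iff_eq (G.degEps_pos hε v).ne').2 ?_
  rw [degEps, deg]
  ring

theorem statMeasEps_nonneg (hε : 0 ≤ ε) (v : Fin G.n) : 0 ≤ G.statMeasEps ε v :=
  div_nonneg (G.degEps_pos hε v).le (Finset.sum_nonneg fun u _ => (G.degEps_pos hε u).le)

theorem sum_statMeasEps (hε : 0 ≤ ε) : ∑ v, G.statMeasEps ε v = 1 := by
  simp only [statMeasEps, ← Finset.sum_div]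
  exact div_self
    (Finset.sum_pos (fun v _ => G.degEps_pos hε v) ⟨⟨0, G.n_pos⟩, Finset.mem_univ _⟩).ne'

theorem sum_kernelEps_smul {E : Type*} [AddCommGroup E] [Module ℝ E] (f : Fin G.n → E)
    (v : Fin G.n) :
    ∑ v', G.kernelEps ε v v' • f v' =
      (1 / (G.deg v + 1 + ε)) • ((1 + ε) • f v + ∑ v', G.w v v' • f v') := by
  simp only [kernelEps, div_eq_inv_mul, mul_smul, add_smul, ite_smul, zero_smul, mul_one,
    ← Finset.smul_sum, Finset.sum_add_distrib, Finset.sum_ite_eq', Finset.mem_univ, if_true]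

end LabeledGraph

/-- Each layer of a normalized GIN applies `φ` to the kernel average of the previous features. -/
theorem ginLabel_succ (ε : ℝ) (dims : ℕ → ℕ)
    (φ : (i : ℕ) → EuclideanSpace ℝ (Fin (dims i)) → EuclideanSpace ℝ (Fin (dims (i + 1))))
    (G : LabeledGraph (dims 0)) (i : ℕ) (v : Fin G.n) :
    ginLabel ε dims φ G (i + 1) v =
      φ i (∑ v', G.kernelEps ε v v' • ginLabel ε dims φ G i v') := by
  rw [G.sum_kernelEps_smul, ginLabel]

section GIN

variable {ε : ℝ} {dims : ℕ → ℕ}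
  {φ : (i : ℕ) → EuclideanSpace ℝ (Fin (dims i)) → EuclideanSpace ℝ (Fin (dims (i + 1)))}
  {G₁ G₂ : LabeledGraph (dims 0)}

theorem dist_ginLabel_succ_le {i : ℕ} {K : NNReal} (hφ : LipschitzWith K (φ i))
    {ν : Fin G₁.n × Fin G₂.n → Fin G₁.n × Fin G₂.n → ℝ}
    (hν : IsOneStepCoupling (G₁.kernelEps ε) (G₂.kernelEps ε) ν) (p : Fin G₁.n × Fin G₂.n) :
    dist (ginLabel ε dims φ G₁ (i + 1) p.1) (ginLabel ε dims φ G₂ (i + 1) p.2) ≤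
      K * ∑ r, ν p r * dist (ginLabel ε dims φ G₁ i r.1) (ginLabel ε dims φ G₂ i r.2) := by
  rw [ginLabel_succ, ginLabel_succ]
  exact (hφ.dist_le_mul _ _).trans
    (mul_le_mul_of_nonneg_left ((hν p).dist_sum_smul_le_s13 _ _) K.coe_nonneg)

/-- The distance between the depth-`k` features of two nodes is controlled by the expected
label distance under any `k`-step coupling started at these nodes. -/
theorem dist_ginLabel_le {k : ℕ} {Cs : ℕ → NNReal}
    (hφ : ∀ i, i < k → LipschitzWith (Cs i) (φ i))
    {ν : Fin G₁.n × Fin G₂.n → Fin G₁.n × Fin G₂.n → ℝ}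
    (hν : IsKStepCoupling (G₁.kernelEps ε) (G₂.kernelEps ε) k ν) (p : Fin G₁.n × Fin G₂.n) :
    dist (ginLabel ε dims φ G₁ k p.1) (ginLabel ε dims φ G₂ k p.2) ≤
      (∏ i ∈ Finset.range k, (Cs i : ℝ)) *
        ∑ r, ν p r * dist (G₁.label r.1) (G₂.label r.2) := by
  induction hν generalizing p with
  | zero ν h => simp [h, ginLabel]
  | one ν h => simpa [ginLabel] using dist_ginLabel_succ_le (hφ 0 one_pos) h p
  | succ k ν' ν₁ ν h' h₁ h ih =>
    calc _ ≤ (Cs k : ℝ) * ∑ s, ν₁ p s *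
            dist (ginLabel ε dims φ G₁ k s.1) (ginLabel ε dims φ G₂ k s.2) :=
          dist_ginLabel_succ_le (hφ k k.lt_succ_self) h₁ p
      _ ≤ (Cs k : ℝ) * ∑ s, ν₁ p s * ((∏ i ∈ Finset.range k, (Cs i : ℝ)) *
            ∑ r, ν' s r * dist (G₁.label r.1) (G₂.label r.2)) := by
          gcongr with s
          · exact (h₁ p).1 s
          · exact ih (fun i hi => hφ i (hi.trans k.lt_succ_self)) s
      _ = _ := by
          simp only [h, Finset.prod_range_succ, Finset.mul_sum, Finset.sum_mul]
          rw [Finset.sum_comm]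
          exact Finset.sum_congr rfl fun r _ => Finset.sum_congr rfl fun s _ => by ring

theorem abs_ginOut_sub_le (hε : 0 ≤ ε) {k : ℕ}
    {ψ : EuclideanSpace ℝ (Fin (dims k)) → ℝ} {Cs : ℕ → NNReal} {C : NNReal}
    (hφ : ∀ i, i < k → LipschitzWith (Cs i) (φ i)) (hψ : LipschitzWith C ψ) :
    |ginOut ε dims k φ ψ G₁ - ginOut ε dims k φ ψ G₂| ≤
      (C : ℝ) * (∏ i ∈ Finset.range k, (Cs i : ℝ)) * dGeps ε k G₁ G₂ := by
  refine le_mul_dWL (by positivity)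
    ⟨_, .prod (G₁.statMeasEps_nonneg hε) (G₂.statMeasEps_nonneg hε)
      (G₁.sum_statMeasEps hε) (G₂.sum_statMeasEps hε)⟩
    (IsOneStepCoupling.exists_isKStepCoupling (fun p =>
      .prod (G₁.kernelEps_nonneg hε p.1) (G₂.kernelEps_nonneg hε p.2)
        (G₁.sum_kernelEps hε p.1) (G₂.sum_kernelEps hε p.2)) k) fun γ ν hγ hν => ?_
  calc |ginOut ε dims k φ ψ G₁ - ginOut ε dims k φ ψ G₂|
      ≤ C * dist (∑ v, G₁.statMeasEps ε v • ginLabel ε dims φ G₁ k v)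
          (∑ v, G₂.statMeasEps ε v • ginLabel ε dims φ G₂ k v) := hψ.dist_le_mul _ _
    _ ≤ C * ∑ p, γ p * dist (ginLabel ε dims φ G₁ k p.1) (ginLabel ε dims φ G₂ k p.2) := by
        gcongr
        exact hγ.dist_sum_smul_le_s13 _ _
    _ ≤ C * ∑ p, γ p * ((∏ i ∈ Finset.range k, (Cs i : ℝ)) *
          ∑ r, ν p r * dist (G₁.label r.1) (G₂.label r.2)) := by
        gcongr with p
        · exact hγ.1 p
        · exact dist_ginLabel_le hφ hν p
    _ = _ := by
        simp only [odotFn, Finset.mul_sum, Finset.sum_mul]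
        rw [Finset.sum_comm]
        exact Finset.sum_congr rfl fun r _ => Finset.sum_congr rfl fun p _ => by ring

end GIN

/-!
STATEMENT 13: Fix `ε ≥ 0` and let `h` be a `k`-layer normalized GIN built from maps
`φ_1,…,φ_k` (here `φ 0,…,φ (k-1)`) and `ψ`, with `φ_i` `C_i`-Lipschitz and `ψ` `C`-Lipschitz.
Then for any two ℝ^d-labeled weighted graphs,
`|h(G₁) − h(G₂)| ≤ C · (∏_{i=1}^{k} C_i) · d_{G,(ε)}^{(k)}(G₁,G₂)`.
-/
theorem normalized_gin_lipschitz_wrt_dWL (ε : ℝ) (hε : 0 ≤ ε)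
    (d : ℕ) (hd : 1 ≤ d) (k : ℕ) (t : ℕ → ℕ)
    (φ : (i : ℕ) → EuclideanSpace ℝ (Fin (dimSeq d t i)) →
      EuclideanSpace ℝ (Fin (dimSeq d t (i + 1))))
    (ψ : EuclideanSpace ℝ (Fin (dimSeq d t k)) → ℝ)
    (Cs : ℕ → NNReal) (C : NNReal)
    (hφ : ∀ i, i < k → LipschitzWith (Cs i) (φ i)) (hψ : LipschitzWith C ψ)
    (G₁ G₂ : LabeledGraph d) :
    |ginOut ε (dimSeq d t) k φ ψ G₁ - ginOut ε (dimSeq d t) k φ ψ G₂| ≤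
      (C : ℝ) * (∏ i ∈ Finset.range k, (Cs i : ℝ)) * dGeps ε k G₁ G₂ := by
  exact abs_ginOut_sub_le (dims := dimSeq d t) hε hφ hψ
end
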